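/- arXiv:2008.13531 — 4 statements merged into one kernel-verified Lean document; each statement's English description precedes it below -/
import Mathlib

section
/- Delaunay cylinders are conformally parameterized CMC-1 surfaces. For every a ∈ [−1/2, ∞) ∖ {0}, the map X_a(t,θ) = (x_a(t)cosθ, x_a(t)sinθ, z_a(t)) satisfies: (i) the conformality identity x_a(t)² = x_a'(t)² + z_a'(t)² for all t (equivalently (X_a)_t · (X_a)_θ = 0 and |(X_a)_t| = |(X_a)_θ|), and (ii) wherever (X_a)_t ∧ (X_a)_θ ≠ 0, the mean curvature of X_a equals 1 at every point; indeed 𝔐(X_a) = (−x_a'' z_a' + z_a'' x_a' + x_a z_a')/(2 x_a³) = 1. -/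
noncomputable section

namespace Delaunay

/-- Vectors in ℝ³. -/
abbrev V3 : Type := Fin 3 → ℝ

/-- Euclidean scalar product on ℝ³. -/
def dot3 (v w : V3) : ℝ := v 0 * w 0 + v 1 * w 1 + v 2 * w 2

/-- Euclidean norm on ℝ³. -/
def norm3 (v : V3) : ℝ := Real.sqrt (dot3 v v)

/-- Cross product on ℝ³. -/
def cross3 (v w : V3) : V3 :=
  ![v 1 * w 2 - v 2 * w 1, v 2 * w 0 - v 0 * w 2, v 0 * w 1 - v 1 * w 0]

/-- Partial derivative with respect to the first variable. -/
def pt {E : Type*} [NormedAddCommGroup E] [NormedSpace ℝ E] (X : ℝ → ℝ → E) (t θ : ℝ) : E :=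
  deriv (fun s => X s θ) t

/-- Partial derivative with respect to the second variable. -/
def pθ {E : Type*} [NormedAddCommGroup E] [NormedSpace ℝ E] (X : ℝ → ℝ → E) (t θ : ℝ) : E :=
  deriv (fun s => X t s) θ

/-- Unit normal vector of a parametrized surface. -/
def normalVec (X : ℝ → ℝ → V3) (t θ : ℝ) : V3 :=
  (norm3 (cross3 (pt X t θ) (pθ X t θ)))⁻¹ • cross3 (pt X t θ) (pθ X t θ)

/-- Mean curvature of a parametrized surface, 𝔐 = (𝓔𝓝 − 2𝓕𝓜 + 𝓖𝓛)/(2(𝓔𝓖 − 𝓕²)). -/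
def meanCurv (X : ℝ → ℝ → V3) (t θ : ℝ) : ℝ :=
  (dot3 (pt X t θ) (pt X t θ) * dot3 (pθ (pθ X) t θ) (normalVec X t θ)
    - 2 * dot3 (pt X t θ) (pθ X t θ) * dot3 (pθ (pt X) t θ) (normalVec X t θ)
    + dot3 (pθ X t θ) (pθ X t θ) * dot3 (pt (pt X) t θ) (normalVec X t θ))
  / (2 * (dot3 (pt X t θ) (pt X t θ) * dot3 (pθ X t θ) (pθ X t θ)
      - dot3 (pt X t θ) (pθ X t θ) ^ 2))

/-- Delaunay cylinder parametrization X_a. -/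
def cyl (x z : ℝ → ℝ) : ℝ → ℝ → V3 := fun t θ =>
  ![x t * Real.cos θ, x t * Real.sin θ, z t]

/-- Delaunay torus parametrization X_{ε,a}. -/
def torus (x z : ℝ → ℝ) (ε : ℝ) : ℝ → ℝ → V3 := fun t θ =>
  ![x t * Real.cos θ,
    (ε⁻¹ + x t * Real.sin θ) * Real.cos (ε * z t),
    (ε⁻¹ + x t * Real.sin θ) * Real.sin (ε * z t)]

/-- Normal graph X + φN over a parametrized surface. -/
def graphMap (X : ℝ → ℝ → V3) (φ : ℝ → ℝ → ℝ) : ℝ → ℝ → V3 := fun t θ =>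
  X t θ + φ t θ • normalVec X t θ

/-- Normal perturbation family s ↦ X + sφN. -/
def pert (X : ℝ → ℝ → V3) (φ : ℝ → ℝ → ℝ) (s : ℝ) : ℝ → ℝ → V3 := fun t θ =>
  X t θ + (s * φ t θ) • normalVec X t θ

/-- Pointwise C² quantity |φ| + |∇φ| + |D²φ|. -/
def C2w (φ : ℝ → ℝ → ℝ) (t θ : ℝ) : ℝ :=
  |φ t θ| + ‖fderiv ℝ (fun p : ℝ × ℝ => φ p.1 p.2) (t, θ)‖
    + ‖fderiv ℝ (fderiv ℝ (fun p : ℝ × ℝ => φ p.1 p.2)) (t, θ)‖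

/-- The normalized Jacobi operator 𝓛 φ = 2x²·(d/ds)[𝔐(X + sφN)]|_{s=0}. -/
def jacobiAt (x : ℝ → ℝ) (X : ℝ → ℝ → V3) (φ : ℝ → ℝ → ℝ) (t θ : ℝ) : ℝ :=
  deriv (fun s : ℝ => 2 * x t ^ 2 * meanCurv (pert X φ s) t θ) 0

/-- The normalized Jacobi operator of the Delaunay cylinder: 𝓛_a φ = Δφ + 2(x² + γ²/x²)φ. -/
def Lop (x : ℝ → ℝ) (γ : ℝ) (φ : ℝ → ℝ → ℝ) (t θ : ℝ) : ℝ :=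
  pt (pt φ) t θ + pθ (pθ φ) t θ + 2 * (x t ^ 2 + γ ^ 2 / x t ^ 2) * φ t θ

/-- The first-order operator 𝓛_a^{(1)} in the expansion of the Jacobi operator of Delaunay
tori (here z_a' = x_a² − γ_a). -/
def L1op (x x' : ℝ → ℝ) (γ : ℝ) (φ : ℝ → ℝ → ℝ) (t θ : ℝ) : ℝ :=
  (-2 * (x t ^ 2 - γ) ^ 2 / x t * Real.sin θ) * pt (pt φ) t θ
  + (((x t ^ 2 - γ) ^ 2 * x' t / x t ^ 2 - 4 * (x t ^ 2 - γ) * x' t) * Real.sin θ) * pt φ t θ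
  + ((x t ^ 2 - γ) ^ 2 / x t * Real.cos θ) * pθ φ t θ
  + 2 * (((x t + γ / x t) * (2 * x t ^ 2 + (x t ^ 2 - γ) - (x t ^ 2 - γ) ^ 3 / x t)
      - 4 * ((x t ^ 2 - γ) ^ 2 / x t) * (x t + γ / x t) ^ 2
      + (x' t ^ 2 / x t) * (x t - γ / x t) ^ 2) * Real.sin θ) * φ t θ

/-- The first variation of the mean curvature along a normal perturbation of an orthogonal
parametrization. -/
def firstVariation (X : ℝ → ℝ → V3) (φ : ℝ → ℝ → ℝ) (t θ : ℝ) : ℝ :=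
  let E := dot3 (pt X t θ) (pt X t θ)
  let G := dot3 (pθ X t θ) (pθ X t θ)
  let N := normalVec X t θ
  let L := dot3 (pt (pt X) t θ) N
  let M := dot3 (pθ (pt X) t θ) N
  let Q := dot3 (pθ (pθ X) t θ) N
  let Nt2 := dot3 (pt (normalVec X) t θ) (pt (normalVec X) t θ)
  let Nθ2 := dot3 (pθ (normalVec X) t θ) (pθ (normalVec X) t θ)
  let dtE := pt (fun u v => dot3 (pt X u v) (pt X u v)) t θ
  let dθE := pθ (fun u v => dot3 (pt X u v) (pt X u v)) t θ
  let dtG := pt (fun u v => dot3 (pθ X u v) (pθ X u v)) t θ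
  let dθG := pθ (fun u v => dot3 (pθ X u v) (pθ X u v)) t θ
  (1 / (2 * E)) * pt (pt φ) t θ + (1 / (2 * G)) * pθ (pθ φ) t θ
  + (dtG / (4 * E * G) - dtE / (4 * E ^ 2)) * pt φ t θ
  + (dθE / (4 * E * G) - dθG / (4 * G ^ 2)) * pθ φ t θ
  + (2 * M ^ 2 / (E * G) - Nθ2 / (2 * G) - Nt2 / (2 * E) + L ^ 2 / E ^ 2 + Q ^ 2 / G ^ 2)
      * φ t θ

/-- The second variation of the mean curvature along a normal perturbation of an orthogonal
parametrization. -/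
def secondVariation (X : ℝ → ℝ → V3) (φ : ℝ → ℝ → ℝ) (t θ : ℝ) : ℝ :=
  let E := dot3 (pt X t θ) (pt X t θ)
  let G := dot3 (pθ X t θ) (pθ X t θ)
  let N := normalVec X t θ
  let L := dot3 (pt (pt X) t θ) N
  let M := dot3 (pθ (pt X) t θ) N
  let Q := dot3 (pθ (pθ X) t θ) N
  let P := dot3 (pt (normalVec X) t θ) (pθ (normalVec X) t θ)
  let Nt2 := dot3 (pt (normalVec X) t θ) (pt (normalVec X) t θ)
  let Nθ2 := dot3 (pθ (normalVec X) t θ) (pθ (normalVec X) t θ)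
  let dtE := pt (fun u v => dot3 (pt X u v) (pt X u v)) t θ
  let dθE := pθ (fun u v => dot3 (pt X u v) (pt X u v)) t θ
  let dtG := pt (fun u v => dot3 (pθ X u v) (pθ X u v)) t θ
  let dθG := pθ (fun u v => dot3 (pθ X u v) (pθ X u v)) t θ
  let Ntt := pt (pt (normalVec X)) t θ
  let Nθθ := pθ (pθ (normalVec X)) t θ
  pt φ t θ ^ 2 * (L / (2 * E ^ 2) - Q / (2 * E * G))
  + pθ φ t θ ^ 2 * (-(L / (2 * E * G)) + Q / (2 * G ^ 2))
  + φ t θ ^ 2 * (-(6 * P * M / (E * G)) + 12 * L * M ^ 2 / (E ^ 2 * G)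
      + 12 * Q * M ^ 2 / (E * G ^ 2) - 3 * L * Nt2 / E ^ 2 - 3 * Q * Nθ2 / G ^ 2
      + 4 * L ^ 3 / E ^ 3 + 4 * Q ^ 3 / G ^ 3)
  + pt φ t θ * pθ φ t θ * (2 * M / (E * G))
  + φ t θ * pt φ t θ * (-(dot3 Nθθ (pt X t θ) / (E * G)) - dot3 Ntt (pt X t θ) / E ^ 2
      - (3 / 2) * L * dtE / E ^ 3 + Q * dtG / (E * G ^ 2) + (1 / 2) * L * dtG / (E ^ 2 * G)
      - (1 / 2) * M * dθG / (E * G ^ 2) - (3 / 2) * M * dθE / (E ^ 2 * G))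
  + φ t θ * pθ φ t θ * (-(dot3 Ntt (pθ X t θ) / (E * G)) - dot3 Nθθ (pθ X t θ) / G ^ 2
      - (3 / 2) * Q * dθG / G ^ 3 + L * dθE / (E ^ 2 * G) + (1 / 2) * Q * dθE / (E * G ^ 2)
      - (1 / 2) * M * dtE / (E ^ 2 * G) - (3 / 2) * M * dtG / (E * G ^ 2))
  + φ t θ * pθ (pθ φ) t θ * (2 * Q / G ^ 2)
  + φ t θ * pt (pt φ) t θ * (2 * L / E ^ 2)
  + φ t θ * pθ (pt φ) t θ * (4 * M / (E * G))

/-- Delaunay cylinders are conformally parameterized CMC-1 surfaces. -/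
theorem delaunay_cylinder_conformal_cmc
    (a : ℝ) (ha1 : -(1/2 : ℝ) ≤ a) (ha2 : a ≠ 0)
    (x x' z : ℝ → ℝ)
    (hx : ∀ t, HasDerivAt x (x' t) t)
    (hx' : ∀ t, HasDerivAt x' ((1 + 2 * (a * (1 + a))) * x t - 2 * x t ^ 3) t)
    (hx0 : x 0 = 1 + a) (hx'0 : x' 0 = 0)
    (hz : ∀ t, HasDerivAt z (x t ^ 2 - a * (1 + a)) t)
    (hz0 : z 0 = 0) :
    (∀ t, x t ^ 2 = x' t ^ 2 + (x t ^ 2 - a * (1 + a)) ^ 2)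
    ∧ (∀ t θ : ℝ, dot3 (pt (cyl x z) t θ) (pθ (cyl x z) t θ) = 0)
    ∧ (∀ t θ : ℝ, dot3 (pt (cyl x z) t θ) (pt (cyl x z) t θ)
        = dot3 (pθ (cyl x z) t θ) (pθ (cyl x z) t θ))
    ∧ (∀ t : ℝ, x t ≠ 0 →
        (-((1 + 2 * (a * (1 + a))) * x t - 2 * x t ^ 3) * (x t ^ 2 - a * (1 + a))
            + (2 * x t * x' t) * x' t + x t * (x t ^ 2 - a * (1 + a)))
          / (2 * x t ^ 3) = 1)
    ∧ (∀ t θ : ℝ, cross3 (pt (cyl x z) t θ) (pθ (cyl x z) t θ) ≠ 0 →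
        meanCurv (cyl x z) t θ = 1) := by
  have hpt : pt (cyl x z) = fun t θ =>
      (![x' t * Real.cos θ, x' t * Real.sin θ, x t ^ 2 - a * (1 + a)] : V3) := by
    funext t θ
    refine HasDerivAt.deriv ?_
    rw [hasDerivAt_pi]
    intro i
    fin_cases i
    · exact (hx t).mul_const _
    · exact (hx t).mul_const _
    · exact hz t
  have hpθ : pθ (cyl x z) = fun t θ =>
      (![x t * (-Real.sin θ), x t * Real.cos θ, 0] : V3) := by
    funext t θ
    refine HasDerivAt.deriv ?_
    rw [hasDerivAt_pi]
    intro i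
    fin_cases i
    · exact (Real.hasDerivAt_cos θ).const_mul _
    · exact (Real.hasDerivAt_sin θ).const_mul _
    · exact hasDerivAt_const _ _
  have hptt : pt (pt (cyl x z)) = fun t θ =>
      (![((1 + 2 * (a * (1 + a))) * x t - 2 * x t ^ 3) * Real.cos θ,
        ((1 + 2 * (a * (1 + a))) * x t - 2 * x t ^ 3) * Real.sin θ, 2 * x t * x' t] : V3) := by
    rw [hpt]
    funext t θ
    refine HasDerivAt.deriv ?_
    rw [hasDerivAt_pi]
    intro i
    fin_cases i
    · exact (hx' t).mul_const _
    · exact (hx' t).mul_const _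
    · have h := ((hx t).pow 2).sub_const (a * (1 + a))
      simpa using h
  have hpθθ : pθ (pθ (cyl x z)) = fun t θ =>
      (![x t * (-Real.cos θ), x t * (-Real.sin θ), 0] : V3) := by
    rw [hpθ]
    funext t θ
    refine HasDerivAt.deriv ?_
    rw [hasDerivAt_pi]
    intro i
    fin_cases i
    · exact (Real.hasDerivAt_sin θ).neg.const_mul _
    · exact (Real.hasDerivAt_cos θ).const_mul _
    · exact hasDerivAt_const _ _
  have hcons : ∀ t, x t ^ 2 = x' t ^ 2 + (x t ^ 2 - a * (1 + a)) ^ 2 := by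
    have hd : ∀ t, HasDerivAt
        (fun t => x' t ^ 2 + (x t ^ 2 - a * (1 + a)) ^ 2 - x t ^ 2) 0 t := by
      intro t
      have h := (((hx' t).pow 2).add ((((hx t).pow 2).sub_const (a * (1 + a))).pow 2)).sub
        ((hx t).pow 2)
      refine h.congr_deriv ?_
      simp
      ring
    intro t
    have hc := is_const_of_deriv_eq_zero (fun t => (hd t).differentiableAt)
      (fun t => (hd t).deriv) t 0
    simp only [hx0, hx'0] at hc
    linear_combination -hc
  have hF : ∀ t θ : ℝ, dot3 (pt (cyl x z) t θ) (pθ (cyl x z) t θ) = 0 := by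
    intro t θ
    simp [hpt, hpθ, dot3]
    ring
  have hG : ∀ t θ : ℝ, dot3 (pθ (cyl x z) t θ) (pθ (cyl x z) t θ) = x t ^ 2 := by
    intro t θ
    simp [hpθ, dot3]
    linear_combination x t ^ 2 * Real.sin_sq_add_cos_sq θ
  have hE : ∀ t θ : ℝ, dot3 (pt (cyl x z) t θ) (pt (cyl x z) t θ) = x t ^ 2 := by
    intro t θ
    simp [hpt, dot3]
    linear_combination x' t ^ 2 * Real.sin_sq_add_cos_sq θ - hcons t
  have hnum : ∀ t : ℝ, -((1 + 2 * (a * (1 + a))) * x t - 2 * x t ^ 3) * (x t ^ 2 - a * (1 + a))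
            + (2 * x t * x' t) * x' t + x t * (x t ^ 2 - a * (1 + a)) = 2 * x t ^ 3 := by
    intro t
    linear_combination -2 * x t * hcons t
  have hcr : ∀ t θ : ℝ, cross3 (pt (cyl x z) t θ) (pθ (cyl x z) t θ) =
      ![-(x t * (x t ^ 2 - a * (1 + a)) * Real.cos θ),
        -(x t * (x t ^ 2 - a * (1 + a)) * Real.sin θ), x t * x' t] := by
    intro t θ
    simp only [hpt, hpθ, cross3]
    ext i
    fin_cases i
    · simp
      ring
    · simp
      ring
    · simp
      linear_combination x t * x' t * Real.sin_sq_add_cos_sq θ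
  refine ⟨hcons, hF, fun t θ => (hE t θ).trans (hG t θ).symm, ?_, ?_⟩
  · intro t h0
    rw [hnum t]
    exact div_self (by positivity)
  · intro t θ hne
    have h0 : x t ≠ 0 := by
      intro h
      apply hne
      rw [hcr, h]
      ext i
      fin_cases i <;> simp
    have hnorm : norm3 (cross3 (pt (cyl x z) t θ) (pθ (cyl x z) t θ)) = x t ^ 2 := by
      rw [norm3, hcr, Real.sqrt_eq_iff_mul_self_eq (by simp [dot3]; nlinarith [mul_self_nonneg (x t * (x t ^ 2 - a * (1 + a)) * Real.cos θ), mul_self_nonneg (x t * (x t ^ 2 - a * (1 + a)) * Real.sin θ), mul_self_nonneg (x t * x' t)]) (by positivity)]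
      simp [dot3]
      linear_combination (-1) * x t ^ 2 * hcons t
        + x t ^ 2 * (x t ^ 2 - a * (1 + a)) ^ 2 * Real.sin_sq_add_cos_sq θ
    have hN : normalVec (cyl x z) t θ = (x t ^ 2)⁻¹ •
      (![-(x t * (x t ^ 2 - a * (1 + a)) * Real.cos θ),
        -(x t * (x t ^ 2 - a * (1 + a)) * Real.sin θ), x t * x' t] : V3) := by
      rw [normalVec, hnorm, hcr]
    have hQ : dot3 (pθ (pθ (cyl x z)) t θ) (normalVec (cyl x z) t θ)
        = x t ^ 2 - a * (1 + a) := by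
      rw [hN, hpθθ]
      simp [dot3]
      field_simp
      linear_combination (x t ^ 2 - a * (1 + a)) * Real.sin_sq_add_cos_sq θ
    have hL : dot3 (pt (pt (cyl x z)) t θ) (normalVec (cyl x z) t θ)
        = (-((1 + 2 * (a * (1 + a))) * x t - 2 * x t ^ 3) * (x t ^ 2 - a * (1 + a))
            + (2 * x t * x' t) * x' t) / x t := by
      rw [hN, hptt]
      simp [dot3]
      field_simp
      linear_combination -((1 + 2 * (a * (1 + a))) - 2 * x t ^ 2) * (x t ^ 2 - a * (1 + a)) * Real.sin_sq_add_cos_sq θ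
    rw [meanCurv, hE, hF, hG, hQ, hL]
    rw [div_eq_one_iff_eq (by simpa using h0)]
    field_simp
    linear_combination x t * hnum t

end Delaunay
end
end

section
/- The Jacobi operator of a Delaunay cylinder. Let a ∈ [−1/2, ∞) ∖ {0}, let X_a(t,θ) = (x_a(t)cosθ, x_a(t)sinθ, z_a(t)) and N_a = ((X_a)_t ∧ (X_a)_θ)/|(X_a)_t ∧ (X_a)_θ| (defined wherever (X_a)_t ∧ (X_a)_θ ≠ 0). Then for every φ ∈ C²(ℝ²) and every (t,θ) with x_a(t) ≠ 0, the derivative at s = 0 of s ↦ 𝔐(X_a + s φ N_a)(t,θ) exists and equals (1/(2x_a(t)²))·[Δφ(t,θ) + 2(x_a(t)² + γ_a²/x_a(t)²)·φ(t,θ)], where Δ = ∂_tt + ∂_θθ. -/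
noncomputable section

namespace Delaunay

/-- Rotationally adapted map. -/
def revMap (r h : ℝ → ℝ → ℝ) : ℝ → ℝ → V3 := fun t θ =>
  ![r t θ * Real.cos θ, r t θ * Real.sin θ, h t θ]

lemma hasDerivAt_vec {f g k : ℝ → ℝ} {f' g' k' t : ℝ} (hf : HasDerivAt f f' t)
    (hg : HasDerivAt g g' t) (hk : HasDerivAt k k' t) :
    HasDerivAt (fun s => (![f s, g s, k s] : V3)) ![f', g', k'] t := by
  rw [hasDerivAt_pi]
  intro i
  fin_cases i
  · simpa using hf
  · simpa using hg
  · simpa using hk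

/-- mean curvature in the rotating frame -/
def frameH (r rt rθ rtt rtθ rθθ ht hθ htt htθ hθθ : ℝ) : ℝ :=
  ((rt ^ 2 + ht ^ 2) * ((rθθ - r) * (-(ht * r)) + 2 * rθ * (ht * rθ - rt * hθ) + hθθ * (rt * r))
    - 2 * (rt * rθ + ht * hθ) *
      (rtθ * (-(ht * r)) + rt * (ht * rθ - rt * hθ) + htθ * (rt * r))
    + (rθ ^ 2 + r ^ 2 + hθ ^ 2) * (rtt * (-(ht * r)) + htt * (rt * r)))
  * (Real.sqrt ((ht * r) ^ 2 + (ht * rθ - rt * hθ) ^ 2 + (rt * r) ^ 2))⁻¹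
  / (2 * ((rt ^ 2 + ht ^ 2) * (rθ ^ 2 + r ^ 2 + hθ ^ 2) - (rt * rθ + ht * hθ) ^ 2))

lemma meanCurv_of_vecs (X : ℝ → ℝ → V3) (t θ c s : ℝ) (hcs : c ^ 2 + s ^ 2 = 1)
    (r rt rθ rtt rtθ rθθ ht hθ htt htθ hθθ : ℝ)
    (h1 : pt X t θ = ![rt * c, rt * s, ht])
    (h2 : pθ X t θ = ![rθ * c - r * s, rθ * s + r * c, hθ])
    (h3 : pt (pt X) t θ = ![rtt * c, rtt * s, htt])
    (h4 : pθ (pt X) t θ = ![rtθ * c - rt * s, rtθ * s + rt * c, htθ])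
    (h5 : pθ (pθ X) t θ = ![(rθθ - r) * c - 2 * rθ * s, (rθθ - r) * s + 2 * rθ * c, hθθ]) :
    meanCurv X t θ = frameH r rt rθ rtt rtθ rθθ ht hθ htt htθ hθθ := by
  have hE : dot3 (pt X t θ) (pt X t θ) = rt ^ 2 + ht ^ 2 := by
    rw [h1]; simp [dot3]; linear_combination rt ^ 2 * hcs
  have hF : dot3 (pt X t θ) (pθ X t θ) = rt * rθ + ht * hθ := by
    rw [h1, h2]; simp [dot3]; linear_combination rt * rθ * hcs
  have hG : dot3 (pθ X t θ) (pθ X t θ) = rθ ^ 2 + r ^ 2 + hθ ^ 2 := by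
    rw [h2]; simp [dot3]; linear_combination (rθ ^ 2 + r ^ 2) * hcs
  have hc : cross3 (pt X t θ) (pθ X t θ) =
      ![(-(ht * r)) * c - (ht * rθ - rt * hθ) * s, (-(ht * r)) * s + (ht * rθ - rt * hθ) * c,
        rt * r] := by
    rw [h1, h2]; ext i; fin_cases i
    · simp [cross3]; ring
    · simp [cross3]; ring
    · simp [cross3]; linear_combination rt * r * hcs
  have hk : norm3 (cross3 (pt X t θ) (pθ X t θ)) =
      Real.sqrt ((ht * r) ^ 2 + (ht * rθ - rt * hθ) ^ 2 + (rt * r) ^ 2) := by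
    rw [hc, norm3]; congr 1; simp [dot3]
    linear_combination ((ht * r) ^ 2 + (ht * rθ - rt * hθ) ^ 2) * hcs
  have hN : ∀ A B C : ℝ, dot3 ![A * c - B * s, A * s + B * c, C] (normalVec X t θ) =
      (A * (-(ht * r)) + B * (ht * rθ - rt * hθ) + C * (rt * r)) *
      (Real.sqrt ((ht * r) ^ 2 + (ht * rθ - rt * hθ) ^ 2 + (rt * r) ^ 2))⁻¹ := by
    intro A B C
    rw [normalVec, hk, hc]
    generalize (Real.sqrt ((ht * r) ^ 2 + (ht * rθ - rt * hθ) ^ 2 + (rt * r) ^ 2))⁻¹ = K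
    simp [dot3]
    linear_combination K * (A * (-(ht * r)) + B * (ht * rθ - rt * hθ)) * hcs
  have hL := hN rtt 0 htt
  simp only [zero_mul, sub_zero, add_zero] at hL
  rw [meanCurv, hE, hF, hG, h3, h4, h5, hN, hN, hL, frameH]
  ring

lemma meanCurv_rev (r h rt ht rθ hθ : ℝ → ℝ → ℝ) (t θ rtt rtθ rθθ htt htθ hθθ : ℝ)
    (Hrt : ∀ᶠ t' in nhds t, ∀ θ', HasDerivAt (fun q => r q θ') (rt t' θ') t')
    (Hht : ∀ᶠ t' in nhds t, ∀ θ', HasDerivAt (fun q => h q θ') (ht t' θ') t')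
    (Hrθ : ∀ θ', HasDerivAt (fun q => r t q) (rθ t θ') θ')
    (Hhθ : ∀ θ', HasDerivAt (fun q => h t q) (hθ t θ') θ')
    (Hrtt : HasDerivAt (fun q => rt q θ) rtt t)
    (Hhtt : HasDerivAt (fun q => ht q θ) htt t)
    (Hrtθ : HasDerivAt (fun q => rt t q) rtθ θ)
    (Hhtθ : HasDerivAt (fun q => ht t q) htθ θ)
    (Hrθθ : HasDerivAt (fun q => rθ t q) rθθ θ)
    (Hhθθ : HasDerivAt (fun q => hθ t q) hθθ θ) :
    meanCurv (revMap r h) t θ =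
      frameH (r t θ) (rt t θ) (rθ t θ) rtt rtθ rθθ (ht t θ) (hθ t θ) htt htθ hθθ := by
  have e1 : ∀ᶠ t' in nhds t, ∀ θ', pt (revMap r h) t' θ' =
      ![rt t' θ' * Real.cos θ', rt t' θ' * Real.sin θ', ht t' θ'] := by
    filter_upwards [Hrt, Hht] with t' a b θ'
    exact (hasDerivAt_vec ((a θ').mul_const _) ((a θ').mul_const _) (b θ')).deriv
  have e2 : ∀ θ', pθ (revMap r h) t θ' =
      ![rθ t θ' * Real.cos θ' - r t θ' * Real.sin θ',
        rθ t θ' * Real.sin θ' + r t θ' * Real.cos θ', hθ t θ'] := by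
    intro θ'
    refine (hasDerivAt_vec ?_ ?_ (Hhθ θ')).deriv
    · exact ((Hrθ θ').mul (Real.hasDerivAt_cos θ')).congr_deriv (by ring)
    · exact ((Hrθ θ').mul (Real.hasDerivAt_sin θ'))
  apply meanCurv_of_vecs _ _ _ (Real.cos θ) (Real.sin θ) (Real.cos_sq_add_sin_sq θ)
  · exact e1.self_of_nhds θ
  · exact e2 θ
  · have : (fun q => pt (revMap r h) q θ) =ᶠ[nhds t]
        fun q => ![rt q θ * Real.cos θ, rt q θ * Real.sin θ, ht q θ] := by
      filter_upwards [e1] with q hq using hq θ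
    rw [pt, this.deriv_eq]
    exact (hasDerivAt_vec (Hrtt.mul_const _) (Hrtt.mul_const _) Hhtt).deriv
  · have : (fun q => pt (revMap r h) t q) =
        fun q => ![rt t q * Real.cos q, rt t q * Real.sin q, ht t q] := by
      funext q; exact e1.self_of_nhds q
    rw [pθ, this]
    refine (hasDerivAt_vec ?_ ?_ Hhtθ).deriv
    · exact (Hrtθ.mul (Real.hasDerivAt_cos θ)).congr_deriv (by ring)
    · exact (Hrtθ.mul (Real.hasDerivAt_sin θ))
  · have : (fun q => pθ (revMap r h) t q) = fun q =>
      ![rθ t q * Real.cos q - r t q * Real.sin q,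
        rθ t q * Real.sin q + r t q * Real.cos q, hθ t q] := by
      funext q; exact e2 q
    rw [pθ, this]
    refine (hasDerivAt_vec ?_ ?_ Hhθθ).deriv
    · exact ((Hrθθ.mul (Real.hasDerivAt_cos θ)).sub
        ((Hrθ θ).mul (Real.hasDerivAt_sin θ))).congr_deriv (by ring)
    · exact ((Hrθθ.mul (Real.hasDerivAt_sin θ)).add
        ((Hrθ θ).mul (Real.hasDerivAt_cos θ))).congr_deriv (by ring)

lemma hasDerivAt_affine (A B : ℝ) : HasDerivAt (fun s : ℝ => A + s * B) B 0 := by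
  simpa using ((hasDerivAt_id (0 : ℝ)).mul_const B).const_add A

/-- derivative at `s = 0` of the frame mean curvature along affine data -/
lemma frameH_deriv (x y v X2 Z2 R Rt Rθ Rtt Rtθ Rθθ Ht Hθ Htt Htθ Hθθ : ℝ) (hx : x ≠ 0)
    (hxy : y ^ 2 + v ^ 2 = x ^ 2) :
    HasDerivAt (fun s : ℝ => frameH (x + s * R) (y + s * Rt) (0 + s * Rθ) (X2 + s * Rtt)
      (0 + s * Rtθ) (0 + s * Rθθ) (v + s * Ht) (0 + s * Hθ) (Z2 + s * Htt) (0 + s * Htθ)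
      (0 + s * Hθθ))
      (((2 * (y * Rt + v * Ht)) * (v * x ^ 2)
        + x ^ 2 * ((Rθθ - R) * (-(v * x)) - x * (-(Ht * x + v * R)) + Hθθ * (y * x))
        + 2 * x * R * (X2 * (-(v * x)) + Z2 * (y * x))
        + x ^ 2 * (Rtt * (-(v * x)) + X2 * (-(Ht * x + v * R)) + Htt * (y * x)
          + Z2 * (Rt * x + y * R))) / (2 * x ^ 6)
       - 3 * (x ^ 2 * (v * x ^ 2) + x ^ 2 * (X2 * (-(v * x)) + Z2 * (y * x))) *
         (2 * (y * Rt + v * Ht) * x ^ 2 + x ^ 2 * (2 * x * R)) / (4 * x ^ 10)) 0 := by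
  have r := hasDerivAt_affine x R
  have rt := hasDerivAt_affine y Rt
  have rθ := hasDerivAt_affine 0 Rθ
  have rtt := hasDerivAt_affine X2 Rtt
  have rtθ := hasDerivAt_affine 0 Rtθ
  have rθθ := hasDerivAt_affine 0 Rθθ
  have ht := hasDerivAt_affine v Ht
  have hθ := hasDerivAt_affine 0 Hθ
  have htt := hasDerivAt_affine Z2 Htt
  have htθ := hasDerivAt_affine 0 Htθ
  have hθθ := hasDerivAt_affine 0 Hθθ
  have n1 := (ht.mul r).neg
  have n2 := (ht.mul rθ).sub (rt.mul hθ)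
  have n3 := rt.mul r
  have E := (rt.pow 2).add (ht.pow 2)
  have F := (rt.mul rθ).add (ht.mul hθ)
  have G := ((rθ.pow 2).add (r.pow 2)).add (hθ.pow 2)
  have N := (((rθθ.sub r).mul n1).add ((rθ.const_mul 2).mul n2)).add (hθθ.mul n3)
  have M := ((rtθ.mul n1).add (rt.mul n2)).add (htθ.mul n3)
  have L := (rtt.mul n1).add (htt.mul n3)
  have Q := ((E.mul N).sub ((F.const_mul 2).mul M)).add (G.mul L)
  have W := ((((ht.mul r).pow 2).add (n2.pow 2)).add (n3.pow 2))
  have D := ((E.mul G).sub (F.pow 2)).const_mul 2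
  have hx2 : (0:ℝ) < x ^ 2 := by positivity
  have hW0 : (v * x) ^ 2 + (y * x) ^ 2 = (x ^ 2) ^ 2 := by
    linear_combination x ^ 2 * hxy
  have hs : Real.sqrt ((v * x) ^ 2 + (y * x) ^ 2) = x ^ 2 := by
    rw [hW0, Real.sqrt_sq hx2.le]
  have hsW := W.sqrt (by simp [hW0, hx])
  have hi := hsW.inv (by simp [hs, hx])
  have fin := (Q.mul hi).div D (by simp [hxy, hx])
  refine (fin.congr_of_eventuallyEq (Filter.Eventually.of_forall fun s => ?_)).congr_deriv ?_
  · simp [frameH]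
  · simp [hs, hxy]
    field_simp
    clear fin hi hsW hs hW0 D W Q L M N G F E n1 n2 n3 r rt rθ rtt rtθ rθθ ht hθ htt htθ hθθ
    linear_combination (-4 * R * (x * v - v * X2 + y * Z2)) * hxy

lemma phi_derivs (φ : ℝ → ℝ → ℝ) (hφ : ContDiff ℝ 2 (fun p : ℝ × ℝ => φ p.1 p.2)) :
    (∀ t θ, HasDerivAt (fun q => φ q θ) (pt φ t θ) t) ∧
    (∀ t θ, HasDerivAt (fun q => φ t q) (pθ φ t θ) θ) ∧
    (∀ t θ, HasDerivAt (fun q => pt φ q θ) (pt (pt φ) t θ) t) ∧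
    (∀ t θ, HasDerivAt (fun q => pt φ t q) (pθ (pt φ) t θ) θ) ∧
    (∀ t θ, HasDerivAt (fun q => pθ φ t q) (pθ (pθ φ) t θ) θ) := by
  set f : ℝ × ℝ → ℝ := fun p => φ p.1 p.2 with hf
  have hd : Differentiable ℝ f := hφ.differentiable (by norm_num)
  have hd2 : Differentiable ℝ (fderiv ℝ f) :=
    (hφ.fderiv_right (m := 1) (by norm_num)).differentiable (by norm_num)
  have c1 : ∀ t θ : ℝ, HasDerivAt (fun q : ℝ => (q, θ)) ((1 : ℝ), (0 : ℝ)) t := fun t θ =>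
    (hasDerivAt_id t).prodMk (hasDerivAt_const t θ)
  have c2 : ∀ t θ : ℝ, HasDerivAt (fun q : ℝ => (t, q)) ((0 : ℝ), (1 : ℝ)) θ := fun t θ =>
    (hasDerivAt_const θ t).prodMk (hasDerivAt_id θ)
  have d1 : ∀ t θ, HasDerivAt (fun q => φ q θ) (fderiv ℝ f (t, θ) (1, 0)) t := fun t θ =>
    HasFDerivAt.comp_hasDerivAt (f := fun q : ℝ => (q, θ)) t (hd (t, θ)).hasFDerivAt (c1 t θ)
  have d2 : ∀ t θ, HasDerivAt (fun q => φ t q) (fderiv ℝ f (t, θ) (0, 1)) θ := fun t θ =>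
    (hd (t, θ)).hasFDerivAt.comp_hasDerivAt θ (c2 t θ)
  have e1 : pt φ = fun t θ => fderiv ℝ f (t, θ) (1, 0) := by
    funext t θ; exact (d1 t θ).deriv
  have e2 : pθ φ = fun t θ => fderiv ℝ f (t, θ) (0, 1) := by
    funext t θ; exact (d2 t θ).deriv
  have g : ∀ v : ℝ × ℝ, Differentiable ℝ (fun p => fderiv ℝ f p v) := fun v =>
    hd2.clm_apply (differentiable_const v)
  have k1 : ∀ (v : ℝ × ℝ) (t θ : ℝ), DifferentiableAt ℝ (fun q => fderiv ℝ f (q, θ) v) t :=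
    fun v t θ => (HasFDerivAt.comp_hasDerivAt (f := fun q : ℝ => (q, θ)) t (g v (t, θ)).hasFDerivAt
      (c1 t θ)).differentiableAt
  have k2 : ∀ (v : ℝ × ℝ) (t θ : ℝ), DifferentiableAt ℝ (fun q => fderiv ℝ f (t, q) v) θ :=
    fun v t θ => ((g v (t, θ)).hasFDerivAt.comp_hasDerivAt θ (c2 t θ)).differentiableAt
  refine ⟨fun t θ => (d1 t θ).differentiableAt.hasDerivAt,
    fun t θ => (d2 t θ).differentiableAt.hasDerivAt, fun t θ => ?_, fun t θ => ?_, fun t θ => ?_⟩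
  · rw [e1]; exact (k1 _ t θ).hasDerivAt
  · rw [e1]; exact (k2 _ t θ).hasDerivAt
  · rw [e2]; exact (k2 _ t θ).hasDerivAt

lemma first_integral (a : ℝ) (x x' : ℝ → ℝ)
    (hx : ∀ t, HasDerivAt x (x' t) t)
    (hx' : ∀ t, HasDerivAt x' ((1 + 2 * (a * (1 + a))) * x t - 2 * x t ^ 3) t)
    (hx0 : x 0 = 1 + a) (hx'0 : x' 0 = 0) (t : ℝ) :
    x' t ^ 2 + (x t ^ 2 - a * (1 + a)) ^ 2 = x t ^ 2 := by
  have h : ∀ t, HasDerivAt (fun t => x' t ^ 2 + (x t ^ 2 - a * (1 + a)) ^ 2 - x t ^ 2) 0 t := by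
    intro t
    exact ((((hx' t).pow 2).add ((((hx t).pow 2).sub_const (a * (1 + a))).pow 2)).sub
      ((hx t).pow 2)).congr_deriv (by simp; ring)
  have := is_const_of_deriv_eq_zero (fun t => (h t).differentiableAt) (fun t => (h t).deriv) t 0
  simp only [hx0, hx'0] at this
  linear_combination this

lemma normal_cyl (a : ℝ) (x x' z : ℝ → ℝ)
    (hx : ∀ t, HasDerivAt x (x' t) t)
    (hz : ∀ t, HasDerivAt z (x t ^ 2 - a * (1 + a)) t)
    (hI : ∀ t, x' t ^ 2 + (x t ^ 2 - a * (1 + a)) ^ 2 = x t ^ 2) (t θ : ℝ) :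
    normalVec (cyl x z) t θ = ![(a * (1 + a) / x t - x t) * Real.cos θ,
      (a * (1 + a) / x t - x t) * Real.sin θ, x' t / x t] := by
  have hcs := Real.cos_sq_add_sin_sq θ
  have e1 : pt (cyl x z) t θ =
      ![x' t * Real.cos θ, x' t * Real.sin θ, x t ^ 2 - a * (1 + a)] :=
    (hasDerivAt_vec ((hx t).mul_const _) ((hx t).mul_const _) (hz t)).deriv
  have e2 : pθ (cyl x z) t θ = ![x t * -Real.sin θ, x t * Real.cos θ, 0] :=
    (hasDerivAt_vec ((Real.hasDerivAt_cos θ).const_mul _) ((Real.hasDerivAt_sin θ).const_mul _)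
      (hasDerivAt_const θ (z t))).deriv
  have hc : cross3 (pt (cyl x z) t θ) (pθ (cyl x z) t θ) =
      ![-((x t ^ 2 - a * (1 + a)) * x t) * Real.cos θ,
        -((x t ^ 2 - a * (1 + a)) * x t) * Real.sin θ, x' t * x t] := by
    rw [e1, e2]; ext i; fin_cases i
    · simp [cross3]; ring
    · simp [cross3]; ring
    · simp [cross3]; linear_combination x' t * x t * hcs
  have hk : norm3 (cross3 (pt (cyl x z) t θ) (pθ (cyl x z) t θ)) = x t ^ 2 := by
    rw [hc, norm3]; refine Eq.trans (congrArg Real.sqrt ?_) (Real.sqrt_sq (sq_nonneg (x t)))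
    simp [dot3]
    linear_combination (x t ^ 2 - a * (1 + a)) ^ 2 * x t ^ 2 * hcs + x t ^ 2 * hI t
  rw [normalVec, hk, hc]
  by_cases h0 : x t = 0
  · ext i; fin_cases i <;> simp [h0]
  · ext i; fin_cases i
    · simp; field_simp; ring
    · simp; field_simp; ring
    · simp; field_simp

lemma pert_eq (a : ℝ) (x x' z : ℝ → ℝ)
    (hx : ∀ t, HasDerivAt x (x' t) t)
    (hz : ∀ t, HasDerivAt z (x t ^ 2 - a * (1 + a)) t)
    (hI : ∀ t, x' t ^ 2 + (x t ^ 2 - a * (1 + a)) ^ 2 = x t ^ 2)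
    (φ : ℝ → ℝ → ℝ) (s : ℝ) :
    pert (cyl x z) φ s = revMap (fun t θ => x t + s * (φ t θ * (a * (1 + a) / x t - x t)))
      (fun t θ => z t + s * (φ t θ * (x' t / x t))) := by
  funext t θ
  rw [pert, normal_cyl a x x' z hx hz hI]
  ext i; fin_cases i
  · simp [cyl, revMap]; ring
  · simp [cyl, revMap]; ring
  · simp [cyl, revMap]; ring


/-- The Jacobi operator of a Delaunay cylinder: the first variation of the
mean curvature along normal perturbations equals (1/(2x²))[Δφ + 2(x² + γ²/x²)φ]. -/
theorem jacobi_operator_delaunay_cylinder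
    (a : ℝ) (ha1 : -(1/2 : ℝ) ≤ a) (ha2 : a ≠ 0)
    (x x' z : ℝ → ℝ)
    (hx : ∀ t, HasDerivAt x (x' t) t)
    (hx' : ∀ t, HasDerivAt x' ((1 + 2 * (a * (1 + a))) * x t - 2 * x t ^ 3) t)
    (hx0 : x 0 = 1 + a) (hx'0 : x' 0 = 0)
    (hz : ∀ t, HasDerivAt z (x t ^ 2 - a * (1 + a)) t)
    (hz0 : z 0 = 0)
    (φ : ℝ → ℝ → ℝ)
    (hφ : ContDiff ℝ 2 (fun p : ℝ × ℝ => φ p.1 p.2)) :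
    ∀ t θ : ℝ, x t ≠ 0 →
      HasDerivAt (fun s : ℝ => meanCurv (pert (cyl x z) φ s) t θ)
        ((1 / (2 * x t ^ 2)) *
          (pt (pt φ) t θ + pθ (pθ φ) t θ
            + 2 * (x t ^ 2 + (a * (1 + a)) ^ 2 / x t ^ 2) * φ t θ)) 0 := by
  intro t θ hxt
  have hI := first_integral a x x' hx hx' hx0 hx'0
  obtain ⟨p1, p2, p11, p12, p22⟩ := phi_derivs φ hφ
  set γ : ℝ := a * (1 + a) with hγ
  -- derivatives of the normal components
  have hu : ∀ q, x q ≠ 0 → HasDerivAt (fun q => γ / x q - x q)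
      (-(γ / x q ^ 2 + 1) * x' q) q := fun q hq =>
    (((hasDerivAt_const q γ).div (hx q) hq).sub (hx q)).congr_deriv (by field_simp; ring)
  have hw : ∀ q, x q ≠ 0 → HasDerivAt (fun q => x' q / x q) (γ ^ 2 / x q ^ 2 - x q ^ 2) q :=
    fun q hq => ((hx' q).div (hx q) hq).congr_deriv (by
      field_simp; linear_combination -(hI q))
  have hu2 : HasDerivAt (fun q => -(γ / x q ^ 2 + 1) * x' q)
      (2 * γ * x' t ^ 2 / x t ^ 3 - (γ / x t ^ 2 + 1) * ((1 + 2 * γ) * x t - 2 * x t ^ 3)) t :=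
    (((((hasDerivAt_const t γ).div ((hx t).pow 2) (pow_ne_zero 2 hxt)).add_const 1).neg).mul
      (hx' t)).congr_deriv (by simp; field_simp; ring)
  have hw2 : HasDerivAt (fun q => γ ^ 2 / x q ^ 2 - x q ^ 2)
      (-2 * γ ^ 2 * x' t / x t ^ 3 - 2 * x t * x' t) t :=
    (((hasDerivAt_const t (γ ^ 2)).div ((hx t).pow 2) (pow_ne_zero 2 hxt)).sub
      ((hx t).pow 2)).congr_deriv (by simp; field_simp)
  have hne : ∀ᶠ q in nhds t, x q ≠ 0 := (hx t).continuousAt.eventually_ne hxt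
  have hz2 : HasDerivAt (fun q => x q ^ 2 - γ) (2 * x t * x' t) t :=
    (((hx t).pow 2).sub_const γ).congr_deriv (by simp)
  have key : ∀ s : ℝ, meanCurv (pert (cyl x z) φ s) t θ =
      frameH (x t + s * (φ t θ * (γ / x t - x t)))
        (x' t + s * (pt φ t θ * (γ / x t - x t) + φ t θ * (-(γ / x t ^ 2 + 1) * x' t)))
        (0 + s * (pθ φ t θ * (γ / x t - x t)))
        (((1 + 2 * γ) * x t - 2 * x t ^ 3) + s * (pt (pt φ) t θ * (γ / x t - x t)
          + pt φ t θ * (-(γ / x t ^ 2 + 1) * x' t) + (pt φ t θ * (-(γ / x t ^ 2 + 1) * x' t)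
          + φ t θ * (2 * γ * x' t ^ 2 / x t ^ 3
            - (γ / x t ^ 2 + 1) * ((1 + 2 * γ) * x t - 2 * x t ^ 3)))))
        (0 + s * (pθ (pt φ) t θ * (γ / x t - x t) + pθ φ t θ * (-(γ / x t ^ 2 + 1) * x' t)))
        (0 + s * (pθ (pθ φ) t θ * (γ / x t - x t)))
        ((x t ^ 2 - γ) + s * (pt φ t θ * (x' t / x t)
          + φ t θ * (γ ^ 2 / x t ^ 2 - x t ^ 2)))
        (0 + s * (pθ φ t θ * (x' t / x t)))
        (2 * x t * x' t + s * (pt (pt φ) t θ * (x' t / x t)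
          + pt φ t θ * (γ ^ 2 / x t ^ 2 - x t ^ 2) + (pt φ t θ * (γ ^ 2 / x t ^ 2 - x t ^ 2)
          + φ t θ * (-2 * γ ^ 2 * x' t / x t ^ 3 - 2 * x t * x' t))))
        (0 + s * (pθ (pt φ) t θ * (x' t / x t) + pθ φ t θ * (γ ^ 2 / x t ^ 2 - x t ^ 2)))
        (0 + s * (pθ (pθ φ) t θ * (x' t / x t))) := by
    intro s
    rw [pert_eq a x x' z hx hz hI φ s]
    apply meanCurv_rev
      (rt := fun t θ => x' t + s * (pt φ t θ * (γ / x t - x t)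
        + φ t θ * (-(γ / x t ^ 2 + 1) * x' t)))
      (ht := fun t θ => (x t ^ 2 - γ) + s * (pt φ t θ * (x' t / x t)
          + φ t θ * (γ ^ 2 / x t ^ 2 - x t ^ 2)))
      (rθ := fun t θ => 0 + s * (pθ φ t θ * (γ / x t - x t)))
      (hθ := fun t θ => 0 + s * (pθ φ t θ * (x' t / x t)))
    · filter_upwards [hne] with q hq θ'
      exact (hx q).add (((p1 q θ').mul (hu q hq)).const_mul s)
    · filter_upwards [hne] with q hq θ'
      exact (hz q).add (((p1 q θ').mul (hw q hq)).const_mul s)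
    · intro θ'
      exact (hasDerivAt_const θ' (x t)).add (((p2 t θ').mul_const _).const_mul s)
    · intro θ'
      exact (hasDerivAt_const θ' (z t)).add (((p2 t θ').mul_const _).const_mul s)
    · exact (hx' t).add ((((p11 t θ).mul (hu t hxt)).add ((p1 t θ).mul hu2)).const_mul s)
    · exact hz2.add ((((p11 t θ).mul (hw t hxt)).add ((p1 t θ).mul hw2)).const_mul s)
    · exact (hasDerivAt_const θ (x' t)).add
        ((((p12 t θ).mul_const _).add ((p2 t θ).mul_const _)).const_mul s)
    · exact (hasDerivAt_const θ (x t ^ 2 - γ)).add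
        ((((p12 t θ).mul_const _).add ((p2 t θ).mul_const _)).const_mul s)
    · exact (hasDerivAt_const θ (0 : ℝ)).add (((p22 t θ).mul_const _).const_mul s)
    · exact (hasDerivAt_const θ (0 : ℝ)).add (((p22 t θ).mul_const _).const_mul s)
  refine ((frameH_deriv (x t) (x' t) (x t ^ 2 - γ) _ _ _ _ _ _ _ _ _ _ _ _ _ hxt
    (hI t)).congr_of_eventuallyEq (Filter.Eventually.of_forall key)).congr_deriv ?_
  have hIt := hI t
  generalize pt (pt φ) t θ = A
  generalize pθ (pθ φ) t θ = B
  generalize pt φ t θ = C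
  generalize φ t θ = P
  generalize x t = X at *
  generalize x' t = Y at *
  clear_value γ
  have hY : Y ^ 2 = X ^ 2 - (X ^ 2 - γ) ^ 2 := by linear_combination hIt
  have hY4 : Y ^ 4 = (X ^ 2 - (X ^ 2 - γ) ^ 2) ^ 2 := by rw [← hY]; ring
  clear key hu2 hw2 hz2 hu hw
  field_simp
  ring_nf
  rw [hY4, hY]
  ring

end Delaunay
end
end

section
/- Jacobi fields of Delaunay surfaces. Fix a ∈ [−1/2, ∞) ∖ {0} and assume the family (b,t) ↦ (x_b(t), z_b(t)) is differentiable with respect to the parameter b at b = a (this holds by smooth dependence on parameters); write ∂_a x_a and ∂_a z_a for these derivatives. Define w_{a,0}^+(t) = −(z_a'/x_a)·∂_a x_a + (x_a'/x_a)·∂_a z_a, w_{a,0}^−(t) = x_a'/x_a, w_{a,1}^+(t) = z_a'/x_a, w_{a,1}^−(t) = x_a' + z_a z_a'/x_a. Then every linear combination of the functions (t,θ) ↦ w_{a,0}^±(t), (t,θ) ↦ w_{a,1}^±(t)cosθ, (t,θ) ↦ w_{a,1}^±(t)sinθ solves Δφ + 2(x_a² + γ_a²/x_a²)φ = 0 on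 ℝ², and is 2π-periodic in θ. -/
noncomputable section

namespace Delaunay

open Filter Topology Set in
/-- Passing to the limit in an integral equation. -/
theorem lim_primitive (f g : ℕ → ℝ → ℝ) (G : ℝ → ℝ) (c : ℝ)
    (hf : ∀ n t, HasDerivAt (f n) (g n t) t) (hg : ∀ n, Continuous (g n))
    (hbd : ∀ T : ℝ, ∃ C : ℝ, ∀ n s, |s| ≤ T → |g n s| ≤ C)
    (hlim : ∀ s, Tendsto (fun n => g n s) atTop (𝓝 (G s)))
    (h0 : Tendsto (fun n => f n 0) atTop (𝓝 c)) :
    Continuous (fun t => c + ∫ s in (0:ℝ)..t, G s) ∧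
      ∀ t, Tendsto (fun n => f n t) atTop (𝓝 (c + ∫ s in (0:ℝ)..t, G s)) := by
  have hmeas : MeasureTheory.StronglyMeasurable G :=
    stronglyMeasurable_of_tendsto atTop (fun n => (hg n).stronglyMeasurable)
      (tendsto_pi_nhds.mpr hlim)
  have habs : ∀ p q s : ℝ, s ∈ uIoc p q → |s| ≤ max |p| |q| := by
    intro p q s hs
    rcases mem_uIoc.mp hs with ⟨h1, h2⟩ | ⟨h1, h2⟩
    · exact abs_le_max_abs_abs h1.le h2
    · rw [max_comm]; exact abs_le_max_abs_abs h1.le h2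
  have hint : ∀ p q : ℝ, IntervalIntegrable G MeasureTheory.volume p q := by
    intro p q
    obtain ⟨C, hC⟩ := hbd (max |p| |q|)
    rw [intervalIntegrable_iff]
    refine MeasureTheory.Measure.integrableOn_of_bounded (M := C) (by simp [uIoc])
      hmeas.aestronglyMeasurable ?_
    refine (MeasureTheory.ae_restrict_mem measurableSet_uIoc).mono fun s hs => ?_
    exact le_of_tendsto (hlim s).norm (Eventually.of_forall fun n => hC n s (habs p q s hs))
  refine ⟨continuous_const.add (intervalIntegral.continuous_primitive hint 0), fun t => ?_⟩
  obtain ⟨C, hC⟩ := hbd (max |0| |t|)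
  have h1 : Tendsto (fun n => ∫ s in (0:ℝ)..t, g n s) atTop (𝓝 (∫ s in (0:ℝ)..t, G s)) := by
    refine intervalIntegral.tendsto_integral_filter_of_dominated_convergence (fun _ => C) ?_ ?_ ?_ ?_
    · exact Eventually.of_forall fun n => (hg n).aestronglyMeasurable
    · exact Eventually.of_forall fun n => Eventually.of_forall fun s hs => hC n s (habs 0 t s hs)
    · exact intervalIntegrable_const
    · exact Eventually.of_forall fun s _ => hlim s
  refine (h0.add h1).congr fun n => ?_
  rw [intervalIntegral.integral_eq_sub_of_hasDerivAt (fun s _ => hf n s)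
    ((hg n).intervalIntegrable _ _)]
  ring

/-- A function with zero derivative is constant. -/
theorem const_of_hasDerivAt_zero (f : ℝ → ℝ) (hf : ∀ t, HasDerivAt f 0 t) (t : ℝ) : f t = f 0 :=
  is_const_of_deriv_eq_zero (fun s => (hf s).differentiableAt) (fun s => (hf s).deriv) t 0

/-- First integral of the Delaunay equation. -/
theorem first_integral_s6 (b : ℝ) (X Y : ℝ → ℝ) (hX : ∀ t, HasDerivAt X (Y t) t)
    (hY : ∀ t, HasDerivAt Y ((1 + 2 * (b * (1 + b))) * X t - 2 * X t ^ 3) t)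
    (hX0 : X 0 = 1 + b) (hY0 : Y 0 = 0) (t : ℝ) :
    Y t ^ 2 = (1 + 2 * (b * (1 + b))) * X t ^ 2 - X t ^ 4 - (b * (1 + b)) ^ 2 := by
  have h := const_of_hasDerivAt_zero
    (fun t => Y t ^ 2 - ((1 + 2 * (b * (1 + b))) * X t ^ 2 - X t ^ 4)) (fun t => by
      have := ((hY t).pow 2).sub ((((hX t).pow 2).const_mul (1 + 2 * (b * (1 + b)))).sub
        ((hX t).pow 4))
      refine this.congr_deriv ?_
      push_cast
      ring) t
  simp only [hX0, hY0] at h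
  linear_combination h

open Set in
/-- Lipschitz dependence on parameters, forward in time. -/
theorem gron_fwd (X Y X2 Y2 : ℝ → ℝ) (γ γ2 M η : ℝ)
    (hX : ∀ t, HasDerivAt X (Y t) t)
    (hY : ∀ t, HasDerivAt Y ((1 + 2 * γ) * X t - 2 * X t ^ 3) t)
    (hX2 : ∀ t, HasDerivAt X2 (Y2 t) t)
    (hY2 : ∀ t, HasDerivAt Y2 ((1 + 2 * γ2) * X2 t - 2 * X2 t ^ 3) t)
    (hM : 1 ≤ M) (hb : ∀ t, X t ^ 2 ≤ M) (hb2 : ∀ t, X2 t ^ 2 ≤ M)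
    (hγ0 : 0 ≤ 1 + 2 * γ) (hγM : 1 + 2 * γ ≤ M) (hγ : |γ2 - γ| ≤ η)
    (h0 : |X2 0 - X 0| ≤ η) (hY0 : Y 0 = 0) (hY20 : Y2 0 = 0) (t : ℝ) (ht : 0 ≤ t) :
    |X2 t - X t| ≤ 2 * η * Real.exp (7 * M * t) ∧ |Y2 t - Y t| ≤ 2 * η * Real.exp (7 * M * t) := by
  have hη : 0 ≤ η := (abs_nonneg _).trans hγ
  set f : ℝ → ℝ × ℝ := fun t => (X2 t - X t, Y2 t - Y t) with hf
  have hd : ∀ s, HasDerivAt f (Y2 s - Y s, ((1 + 2 * γ2) * X2 s - 2 * X2 s ^ 3)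
      - ((1 + 2 * γ) * X s - 2 * X s ^ 3)) s := fun s =>
    ((hX2 s).sub (hX s)).prodMk ((hY2 s).sub (hY s))
  have key := norm_le_gronwallBound_of_norm_deriv_right_le (f := f) (δ := η) (K := 7 * M)
    (ε := 2 * M * η) (a := 0) (b := t)
    (fun s _ => (hd s).continuousAt.continuousWithinAt) (fun s _ => (hd s).hasDerivWithinAt)
    (by simp only [hf, Prod.norm_def, hY0, hY20, Real.norm_eq_abs]; simpa using h0)
    (by
      intro s _
      have e1 : |X2 s - X s| ≤ ‖f s‖ := le_max_left _ _
      have e2 : |Y2 s - Y s| ≤ ‖f s‖ := le_max_right _ _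
      have e0 := norm_nonneg (f s)
      refine max_le ?_ ?_
      · simp only [Real.norm_eq_abs]
        nlinarith [mul_nonneg (by linarith : (0:ℝ) ≤ M) hη]
      · simp only [Real.norm_eq_abs]
        have e3 : ((1 + 2 * γ2) * X2 s - 2 * X2 s ^ 3) - ((1 + 2 * γ) * X s - 2 * X s ^ 3)
          = (X2 s - X s) * ((1 + 2 * γ) - 2 * (X2 s ^ 2 + X2 s * X s + X s ^ 2))
            + 2 * ((γ2 - γ) * X2 s) := by ring
        have q1 := hb s
        have q2 := hb2 s
        have e4 : |(1 + 2 * γ) - 2 * (X2 s ^ 2 + X2 s * X s + X s ^ 2)| ≤ 7 * M := by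
          rw [abs_le]
          constructor <;> nlinarith [sq_nonneg (X2 s + X s), sq_nonneg (X2 s - X s)]
        have e5 : |X2 s| ≤ M := by
          refine abs_le_of_sq_le_sq (by nlinarith) (by linarith)
        rw [e3]
        calc _ ≤ |(X2 s - X s) * ((1 + 2 * γ) - 2 * (X2 s ^ 2 + X2 s * X s + X s ^ 2))|
              + |2 * ((γ2 - γ) * X2 s)| := abs_add_le _ _
          _ = |X2 s - X s| * |(1 + 2 * γ) - 2 * (X2 s ^ 2 + X2 s * X s + X s ^ 2)|
              + 2 * (|γ2 - γ| * |X2 s|) := by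
                rw [abs_mul, abs_mul, abs_mul, abs_two]
          _ ≤ ‖f s‖ * (7 * M) + 2 * (η * M) := by gcongr
          _ = _ := by ring)
    t ⟨ht, le_refl t⟩
  have hK : 7 * M ≠ 0 := by positivity
  rw [gronwallBound_of_K_ne_0 hK, sub_zero] at key
  have key2 : ‖f t‖ ≤ 2 * η * Real.exp (7 * M * t) := by
    refine key.trans ?_
    have : 2 * M * η / (7 * M) = 2 / 7 * η := by
      have : M ≠ 0 := by positivity
      field_simp
    simp only [this]
    have := Real.exp_pos (7 * M * t)
    nlinarith [mul_nonneg hη this.le]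
  exact ⟨(le_max_left _ _).trans key2, (le_max_right _ _).trans key2⟩

/-- Lipschitz dependence on parameters. -/
theorem gron (X Y X2 Y2 : ℝ → ℝ) (γ γ2 M η : ℝ)
    (hX : ∀ t, HasDerivAt X (Y t) t)
    (hY : ∀ t, HasDerivAt Y ((1 + 2 * γ) * X t - 2 * X t ^ 3) t)
    (hX2 : ∀ t, HasDerivAt X2 (Y2 t) t)
    (hY2 : ∀ t, HasDerivAt Y2 ((1 + 2 * γ2) * X2 t - 2 * X2 t ^ 3) t)
    (hM : 1 ≤ M) (hb : ∀ t, X t ^ 2 ≤ M) (hb2 : ∀ t, X2 t ^ 2 ≤ M)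
    (hγ0 : 0 ≤ 1 + 2 * γ) (hγM : 1 + 2 * γ ≤ M) (hγ : |γ2 - γ| ≤ η)
    (h0 : |X2 0 - X 0| ≤ η) (hY0 : Y 0 = 0) (hY20 : Y2 0 = 0) (t : ℝ) :
    |X2 t - X t| ≤ 2 * η * Real.exp (7 * M * |t|) ∧
      |Y2 t - Y t| ≤ 2 * η * Real.exp (7 * M * |t|) := by
  rcases le_total 0 t with ht | ht
  · rw [abs_of_nonneg ht]
    exact gron_fwd X Y X2 Y2 γ γ2 M η hX hY hX2 hY2 hM hb hb2 hγ0 hγM hγ h0 hY0 hY20 t ht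
  · have hr : ∀ (F F' : ℝ → ℝ), (∀ t, HasDerivAt F (F' t) t) →
        ∀ t, HasDerivAt (fun s => F (-s)) (-(F' (-t))) t := by
      intro F F' h t
      exact ((h (-t)).comp t (hasDerivAt_neg t)).congr_deriv (by ring)
    have := gron_fwd (fun s => X (-s)) (fun s => -(Y (-s))) (fun s => X2 (-s)) (fun s => -(Y2 (-s)))
      γ γ2 M η (hr X Y hX)
      (fun t => ((hr Y _ hY t).neg).congr_deriv (by ring))
      (hr X2 Y2 hX2)
      (fun t => ((hr Y2 _ hY2 t).neg).congr_deriv (by ring))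
      hM (fun s => hb _) (fun s => hb2 _) hγ0 hγM hγ (by simpa using h0) (by simpa using hY0)
      (by simpa using hY20) (-t) (by linarith)
    rw [abs_of_nonpos ht]
    simp only [neg_neg] at this
    refine ⟨this.1, ?_⟩
    rw [← abs_neg]
    convert this.2 using 2
    ring

open Filter Topology Set in
/-- The linearized Delaunay equation. -/
theorem linearized (a : ℝ) (ha1 : -(1/2 : ℝ) ≤ a) (ha2 : a ≠ 0)
    (x x' z : ℝ → ℝ → ℝ)
    (hx : ∀ b, -(1/2 : ℝ) ≤ b → b ≠ 0 → ∀ t, HasDerivAt (x b) (x' b t) t)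
    (hx' : ∀ b, -(1/2 : ℝ) ≤ b → b ≠ 0 → ∀ t,
      HasDerivAt (x' b) ((1 + 2 * (b * (1 + b))) * x b t - 2 * x b t ^ 3) t)
    (hx0 : ∀ b, -(1/2 : ℝ) ≤ b → b ≠ 0 → x b 0 = 1 + b)
    (hx'0 : ∀ b, -(1/2 : ℝ) ≤ b → b ≠ 0 → x' b 0 = 0)
    (hz : ∀ b, -(1/2 : ℝ) ≤ b → b ≠ 0 → ∀ t,
      HasDerivAt (z b) (x b t ^ 2 - b * (1 + b)) t)
    (hz0 : ∀ b, -(1/2 : ℝ) ≤ b → b ≠ 0 → z b 0 = 0)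
    (dx dz : ℝ → ℝ)
    (hdx : ∀ t, HasDerivAt (fun b => x b t) (dx t) a)
    (hdz : ∀ t, HasDerivAt (fun b => z b t) (dz t) a) :
    ∃ W : ℝ → ℝ, (∀ t, HasDerivAt dx (W t) t) ∧
      (∀ t, HasDerivAt W (dx t * ((1 + 2 * (a * (1 + a))) - 6 * x a t ^ 2)
        + 2 * (1 + 2 * a) * x a t) t) ∧
      (∀ t, HasDerivAt dz (2 * x a t * dx t - (1 + 2 * a)) t) ∧ dx 0 = 1 ∧ W 0 = 0 := by
  obtain ⟨d, hd0, hd1, hd2⟩ : ∃ d : ℝ, 0 < d ∧ d ≤ 1 ∧ ∀ s, 0 < s → s ≤ d → a + s ≠ 0 := by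
    rcases lt_or_gt_of_ne ha2 with h | h
    · exact ⟨-a/2, by linarith, by linarith, fun s h1 h2 => by linarith⟩
    · exact ⟨1, by norm_num, le_refl _, fun s h1 h2 => by linarith⟩
  set h : ℕ → ℝ := fun n => d * (1 / ((n:ℝ) + 1)) with hh
  have hhpos : ∀ n, 0 < h n := fun n => by simp only [hh]; positivity
  have hhle : ∀ n, h n ≤ d := fun n => by
    simp only [hh]
    have h1 : 1 / ((n:ℝ) + 1) ≤ 1 := by
      rw [div_le_one (by positivity)]
      have : (0:ℝ) ≤ n := by positivity
      linarith
    nlinarith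
  have hhlim : Tendsto h atTop (𝓝 0) := by
    have := (tendsto_one_div_add_atTop_nhds_zero_nat (𝕜 := ℝ)).const_mul d
    rwa [mul_zero] at this
  set b : ℕ → ℝ := fun n => a + h n with hbdef
  have hba : ∀ n, b n = a + h n := fun n => rfl
  have hb1 : ∀ n, -(1/2 : ℝ) ≤ b n := fun n => by have := hhpos n; rw [hba]; linarith
  have hb2 : ∀ n, b n ≠ 0 := fun n => hd2 _ (hhpos n) (hhle n)
  have hblim : Tendsto b atTop (𝓝 a) := by simpa using hhlim.const_add a
  have hblim' : Tendsto b atTop (𝓝[≠] a) :=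
    tendsto_nhdsWithin_iff.mpr ⟨hblim, Eventually.of_forall fun n => by
      have := hhpos n
      simp only [mem_compl_iff, mem_singleton_iff, hba]; linarith⟩
  -- difference quotients
  have hu : ∀ t, Tendsto (fun n => (x (b n) t - x a t) / h n) atTop (𝓝 (dx t)) := fun t => by
    refine ((hasDerivAt_iff_tendsto_slope.mp (hdx t)).comp hblim').congr fun n => ?_
    simp [slope_def_field, hba]
  have hv : ∀ t, Tendsto (fun n => (z (b n) t - z a t) / h n) atTop (𝓝 (dz t)) := fun t => by
    refine ((hasDerivAt_iff_tendsto_slope.mp (hdz t)).comp hblim').congr fun n => ?_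
    simp [slope_def_field, hba]
  have hxb : ∀ t, Tendsto (fun n => x (b n) t) atTop (𝓝 (x a t)) := fun t =>
    (hdx t).continuousAt.tendsto.comp hblim
  have hcx : ∀ c, -(1/2 : ℝ) ≤ c → c ≠ 0 → Continuous (x c) := fun c h1 h2 =>
    continuous_iff_continuousAt.mpr fun t => (hx c h1 h2 t).continuousAt
  have hcx' : ∀ c, -(1/2 : ℝ) ≤ c → c ≠ 0 → Continuous (x' c) := fun c h1 h2 =>
    continuous_iff_continuousAt.mpr fun t => (hx' c h1 h2 t).continuousAt
  have hcxa := hcx a ha1 ha2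
  have hcxb := fun n => hcx (b n) (hb1 n) (hb2 n)
  -- bounds
  set M : ℝ := 1 + 2 * ((a + 1) * (a + 2)) with hMdef
  have hM1 : 1 ≤ M := by nlinarith
  have hγM : ∀ c, -(1/2 : ℝ) ≤ c → c ≤ a + 1 → 1 + 2 * (c * (1 + c)) ≤ M := fun c h1 h2 => by
    nlinarith
  have hxM : ∀ c, -(1/2 : ℝ) ≤ c → c ≠ 0 → c ≤ a + 1 → ∀ t, x c t ^ 2 ≤ M := by
    intro c h1 h2 h3 t
    have e := first_integral_s6 c (x c) (x' c) (hx c h1 h2) (hx' c h1 h2) (hx0 c h1 h2)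
      (hx'0 c h1 h2) t
    have e1 := hγM c h1 h3
    by_contra hc
    push Not at hc
    have e2 : x c t ^ 2 * ((1 + 2 * (c * (1 + c))) - x c t ^ 2) < 0 :=
      mul_neg_of_pos_of_neg (by linarith) (by linarith)
    nlinarith [sq_nonneg (x' c t), sq_nonneg (c * (1 + c))]
  have hble : ∀ n, b n ≤ a + 1 := fun n => by have := hhle n; rw [hba]; linarith
  have hlip : ∀ n t, |x (b n) t - x a t| ≤ 2 * (h n * (2 * a + 2)) * Real.exp (7 * M * |t|) ∧
      |x' (b n) t - x' a t| ≤ 2 * (h n * (2 * a + 2)) * Real.exp (7 * M * |t|) := by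
    intro n t
    have hp := hhpos n
    refine gron (x a) (x' a) (x (b n)) (x' (b n)) (a * (1 + a)) (b n * (1 + b n)) M
      (h n * (2 * a + 2)) (hx a ha1 ha2) (hx' a ha1 ha2) (hx _ (hb1 n) (hb2 n))
      (hx' _ (hb1 n) (hb2 n)) hM1 (hxM a ha1 ha2 (by linarith)) (hxM _ (hb1 n) (hb2 n) (hble n))
      (by nlinarith [sq_nonneg (a + 1/2)]) (hγM a ha1 (by linarith)) ?_ ?_ (hx'0 a ha1 ha2)
      (hx'0 _ (hb1 n) (hb2 n)) t
    · have : b n * (1 + b n) - a * (1 + a) = h n * (1 + a + b n) := by rw [hba]; ring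
      rw [this, abs_mul, abs_of_pos hp]
      have e1 := hb1 n
      have e2 := hble n
      rw [abs_of_nonneg (by linarith)]
      exact mul_le_mul_of_nonneg_left (by linarith) hp.le
    · rw [hx0 _ (hb1 n) (hb2 n), hx0 a ha1 ha2, hba]
      have : 1 + (a + h n) - (1 + a) = h n := by ring
      rw [this, abs_of_pos hp]
      nlinarith
  have hquot : ∀ T : ℝ, ∃ C : ℝ, 0 ≤ C ∧ ∀ n s, |s| ≤ T → |(x (b n) s - x a s) / h n| ≤ C ∧
      |(x' (b n) s - x' a s) / h n| ≤ C := by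
    intro T
    refine ⟨2 * (2 * a + 2) * Real.exp (7 * M * T), ?_, fun n s hs => ?_⟩
    · have := Real.exp_pos (7 * M * T)
      have : 0 ≤ 2 * (2 * a + 2) := by linarith
      positivity
    have hp := hhpos n
    have e1 : Real.exp (7 * M * |s|) ≤ Real.exp (7 * M * T) := by
      apply Real.exp_le_exp.mpr
      exact mul_le_mul_of_nonneg_left hs (by linarith)
    have e2 : 2 * (h n * (2 * a + 2)) * Real.exp (7 * M * |s|)
        ≤ 2 * (2 * a + 2) * Real.exp (7 * M * T) * h n := by
      have : 0 ≤ 2 * (h n * (2 * a + 2)) := by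
        have : 0 ≤ 2 * a + 2 := by linarith
        positivity
      calc _ ≤ 2 * (h n * (2 * a + 2)) * Real.exp (7 * M * T) :=
            mul_le_mul_of_nonneg_left e1 this
        _ = _ := by ring
    constructor
    · rw [abs_div, abs_of_pos hp, div_le_iff₀ hp]
      exact (hlip n s).1.trans e2
    · rw [abs_div, abs_of_pos hp, div_le_iff₀ hp]
      exact (hlip n s).2.trans e2
  have hxabs : ∀ c, -(1/2 : ℝ) ≤ c → c ≠ 0 → c ≤ a + 1 → ∀ t, |x c t| ≤ M := by
    intro c h1 h2 h3 t
    have := hxM c h1 h2 h3 t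
    exact abs_le_of_sq_le_sq (by nlinarith) (by linarith)
  have hxa := hxabs a ha1 ha2 (by linarith)
  have hxbM := fun n => hxabs _ (hb1 n) (hb2 n) (hble n)
  have hab : ∀ n, |1 + a + b n| ≤ 2 * a + 2 := fun n => by
    have e1 := hb1 n
    have e2 := hble n
    rw [abs_of_nonneg (by linarith)]; linarith
  have hc2 : 0 ≤ 2 * a + 2 := by linarith
  have hM0 : 0 ≤ M := by linarith
  have hablim : Tendsto (fun n => 1 + a + b n) atTop (𝓝 (1 + 2 * a)) := by
    have := hblim.const_add (1 + a)
    convert this using 2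
    ring
  -- step 1: the derivative quotients converge
  set G : ℝ → ℝ := fun t => dx t * ((1 + 2 * (a * (1 + a))) - 6 * x a t ^ 2)
        + 2 * (1 + 2 * a) * x a t with hG
  obtain ⟨hWc, hWlim⟩ := lim_primitive (fun n t => (x' (b n) t - x' a t) / h n)
    (fun n t => (x (b n) t - x a t) / h n * ((1 + 2 * (a * (1 + a)))
      - 2 * (x (b n) t ^ 2 + x (b n) t * x a t + x a t ^ 2)) + 2 * (1 + a + b n) * x (b n) t)
    G 0
    (by
      intro n t
      refine (((hx' _ (hb1 n) (hb2 n) t).sub (hx' a ha1 ha2 t)).div_const (h n)).congr_deriv ?_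
      have := (hhpos n).ne'
      field_simp
      rw [hba n]
      ring)
    (by
      intro n
      have := hcxb n
      fun_prop)
    (by
      intro T
      obtain ⟨C, hC0, hC⟩ := hquot T
      refine ⟨C * (7 * M) + 2 * (2 * a + 2) * M, fun n s hs => ?_⟩
      have q1 := hxM a ha1 ha2 (by linarith) s
      have q2 := hxM _ (hb1 n) (hb2 n) (hble n) s
      have q3 := hγM a ha1 (by linarith)
      have e4 : |(1 + 2 * (a * (1 + a))) - 2 * (x (b n) s ^ 2 + x (b n) s * x a s + x a s ^ 2)|
          ≤ 7 * M := by
        rw [abs_le]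
        constructor <;> nlinarith [sq_nonneg (x (b n) s + x a s), sq_nonneg (x (b n) s - x a s),
          sq_nonneg (a + 1/2)]
      refine (abs_add_le _ _).trans ?_
      rw [abs_mul, abs_mul (2 * (1 + a + b n)), abs_mul 2, abs_two]
      have e5 := (hC n s hs).1
      have e6 := hxbM n s
      have e7 := hab n
      gcongr)
    (by
      intro s
      have l1 := hxb s
      have l2 : Tendsto (fun _ : ℕ => x a s) atTop (𝓝 (x a s)) := tendsto_const_nhds
      have := ((hu s).mul ((((l1.pow 2).add (l1.mul l2)).add (l2.pow 2)).const_mul 2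
        |>.const_sub (1 + 2 * (a * (1 + a))))).add ((hablim.const_mul 2).mul l1)
      convert this using 2
      simp only [hG]
      ring)
    (by
      refine tendsto_const_nhds.congr fun n => ?_
      rw [hx'0 _ (hb1 n) (hb2 n), hx'0 a ha1 ha2]; simp)
  -- step 2
  set W : ℝ → ℝ := fun t => 0 + ∫ s in (0:ℝ)..t, G s with hW
  obtain ⟨-, hxlim⟩ := lim_primitive (fun n t => (x (b n) t - x a t) / h n)
    (fun n t => (x' (b n) t - x' a t) / h n) W 1
    (fun n t => ((hx _ (hb1 n) (hb2 n) t).sub (hx a ha1 ha2 t)).div_const (h n))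
    (by
      intro n
      have := hcx' _ (hb1 n) (hb2 n)
      have := hcx' a ha1 ha2
      fun_prop)
    (fun T => by
      obtain ⟨C, hC0, hC⟩ := hquot T
      exact ⟨C, fun n s hs => (hC n s hs).2⟩)
    hWlim
    (by
      refine tendsto_const_nhds.congr fun n => ?_
      have := (hhpos n).ne'
      rw [hx0 _ (hb1 n) (hb2 n), hx0 a ha1 ha2, hba]; field_simp; ring)
  have hdxeq : dx = fun t => 1 + ∫ s in (0:ℝ)..t, W s :=
    funext fun t => tendsto_nhds_unique (hu t) (hxlim t)
  have hdxd : ∀ t, HasDerivAt dx (W t) t := fun t => by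
    rw [hdxeq]
    exact ((hWc.integral_hasStrictDerivAt 0 t).hasDerivAt).const_add 1
  have hdxc : Continuous dx := continuous_iff_continuousAt.mpr fun t => (hdxd t).continuousAt
  have hGc : Continuous G := by simp only [hG]; fun_prop
  have hWd : ∀ t, HasDerivAt W (G t) t := fun t =>
    ((hGc.integral_hasStrictDerivAt 0 t).hasDerivAt).const_add 0
  -- step 3
  obtain ⟨-, hzlim⟩ := lim_primitive (fun n t => (z (b n) t - z a t) / h n)
    (fun n t => (x (b n) t + x a t) * ((x (b n) t - x a t) / h n) - (1 + a + b n))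
    (fun t => 2 * x a t * dx t - (1 + 2 * a)) 0
    (by
      intro n t
      refine (((hz _ (hb1 n) (hb2 n) t).sub (hz a ha1 ha2 t)).div_const (h n)).congr_deriv ?_
      have := (hhpos n).ne'
      field_simp
      rw [hba n]
      ring)
    (by
      intro n
      have := hcxb n
      fun_prop)
    (by
      intro T
      obtain ⟨C, hC0, hC⟩ := hquot T
      refine ⟨(M + M) * C + (2 * a + 2), fun n s hs => ?_⟩
      refine (abs_sub _ _).trans ?_
      rw [abs_mul]
      have e5 := (hC n s hs).1
      have e6 := (abs_add_le (x (b n) s) (x a s)).trans (add_le_add (hxbM n s) (hxa s))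
      have e7 := hab n
      gcongr)
    (by
      intro s
      have := (((hxb s).add_const (x a s)).mul (hu s)).sub hablim
      convert this using 2
      ring)
    (by
      refine tendsto_const_nhds.congr fun n => ?_
      rw [hz0 _ (hb1 n) (hb2 n), hz0 a ha1 ha2]; simp)
  have hdzeq : dz = fun t => 0 + ∫ s in (0:ℝ)..t, (2 * x a s * dx s - (1 + 2 * a)) :=
    funext fun t => tendsto_nhds_unique (hv t) (hzlim t)
  refine ⟨W, hdxd, hWd, fun t => ?_, ?_, ?_⟩
  · have hc : Continuous fun t => 2 * x a t * dx t - (1 + 2 * a) := by fun_prop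
    rw [hdzeq]
    exact ((hc.integral_hasStrictDerivAt 0 t).hasDerivAt).const_add 0
  · rw [hdxeq]; simp
  · simp [hW]

/-- Twice differentiable solution of the mode equation with frequency parameter k. -/
def ModeSol (X : ℝ → ℝ) (γ k : ℝ) (w : ℝ → ℝ) : Prop :=
  ∃ w1 : ℝ → ℝ, (∀ t, HasDerivAt w (w1 t) t) ∧
    ∀ t, HasDerivAt w1 ((k - 2 * (X t ^ 2 + γ ^ 2 / X t ^ 2)) * w t) t

section modes

variable (X Y Z : ℝ → ℝ) (γ : ℝ)

theorem hB (hne : ∀ t, X t ≠ 0)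
    (hX : ∀ t, HasDerivAt X (Y t) t)
    (hY : ∀ t, HasDerivAt Y ((1 + 2 * γ) * X t - 2 * X t ^ 3) t)
    (hI : ∀ t, Y t ^ 2 = (1 + 2 * γ) * X t ^ 2 - X t ^ 4 - γ ^ 2) (t : ℝ) :
    HasDerivAt (fun t => Y t / X t) (-X t ^ 2 + γ ^ 2 / X t ^ 2) t := by
  refine ((hY t).div (hX t) (hne t)).congr_deriv ?_
  have := hne t
  field_simp
  linear_combination -(hI t)

theorem hB' (hne : ∀ t, X t ≠ 0)
    (hX : ∀ t, HasDerivAt X (Y t) t) (t : ℝ) :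
    HasDerivAt (fun t => -X t ^ 2 + γ ^ 2 / X t ^ 2)
      ((0 - 2 * (X t ^ 2 + γ ^ 2 / X t ^ 2)) * (Y t / X t)) t := by
  have := hne t
  refine (((hX t).pow 2).neg.add ((hasDerivAt_const t (γ ^ 2)).div ((hX t).pow 2)
    (pow_ne_zero 2 this))).congr_deriv ?_
  simp only [Pi.pow_apply]
  push_cast
  field_simp
  ring

theorem hA (hne : ∀ t, X t ≠ 0)
    (hX : ∀ t, HasDerivAt X (Y t) t) (t : ℝ) :
    HasDerivAt (fun t => (X t ^ 2 - γ) / X t) (Y t * (1 + γ / X t ^ 2)) t := by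
  have := hne t
  refine ((((hX t).pow 2).sub_const γ).div (hX t) this).congr_deriv ?_
  simp only [Pi.pow_apply]
  push_cast
  field_simp
  ring

/-- Derivative of γ / x². -/
theorem hQ (hne : ∀ t, X t ≠ 0)
    (hX : ∀ t, HasDerivAt X (Y t) t) (t : ℝ) :
    HasDerivAt (fun t => γ / X t ^ 2) (-2 * γ * Y t / X t ^ 3) t := by
  have := hne t
  refine ((hasDerivAt_const t γ).div ((hX t).pow 2) (pow_ne_zero 2 this)).congr_deriv ?_
  simp only [Pi.pow_apply]
  push_cast
  field_simp
  ring

theorem mode0m (hne : ∀ t, X t ≠ 0)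
    (hX : ∀ t, HasDerivAt X (Y t) t)
    (hY : ∀ t, HasDerivAt Y ((1 + 2 * γ) * X t - 2 * X t ^ 3) t)
    (hI : ∀ t, Y t ^ 2 = (1 + 2 * γ) * X t ^ 2 - X t ^ 4 - γ ^ 2) :
    ModeSol X γ 0 (fun t => Y t / X t) :=
  ⟨_, hB X Y γ hne hX hY hI, hB' X Y γ hne hX⟩

theorem mode1p (hne : ∀ t, X t ≠ 0)
    (hX : ∀ t, HasDerivAt X (Y t) t)
    (hY : ∀ t, HasDerivAt Y ((1 + 2 * γ) * X t - 2 * X t ^ 3) t)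
    (hI : ∀ t, Y t ^ 2 = (1 + 2 * γ) * X t ^ 2 - X t ^ 4 - γ ^ 2) :
    ModeSol X γ 1 (fun t => (X t ^ 2 - γ) / X t) := by
  refine ⟨_, hA X Y γ hne hX, fun t => ?_⟩
  refine ((hY t).mul ((hQ X Y γ hne hX t).const_add 1)).congr_deriv ?_
  have := hne t
  have h := hI t
  field_simp
  linear_combination (-2 * γ) * h

theorem mode1m (hne : ∀ t, X t ≠ 0)
    (hX : ∀ t, HasDerivAt X (Y t) t)
    (hY : ∀ t, HasDerivAt Y ((1 + 2 * γ) * X t - 2 * X t ^ 3) t)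
    (hZ : ∀ t, HasDerivAt Z (X t ^ 2 - γ) t)
    (hI : ∀ t, Y t ^ 2 = (1 + 2 * γ) * X t ^ 2 - X t ^ 4 - γ ^ 2) :
    ModeSol X γ 1 (fun t => Y t + Z t * (X t ^ 2 - γ) / X t) := by
  refine ⟨fun t => ((1 + 2 * γ) * X t - 2 * X t ^ 3) + ((X t ^ 2 - γ) * ((X t ^ 2 - γ) / X t)
      + Z t * (Y t * (1 + γ / X t ^ 2))), fun t => ?_, fun t => ?_⟩
  · have := (hY t).add ((hZ t).mul (hA X Y γ hne hX t))
    refine this.congr_of_eventuallyEq (Filter.Eventually.of_forall fun s => ?_)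
    simp only [Pi.add_apply, Pi.mul_apply]
    ring
  · have := hne t
    have h := hI t
    refine ((((hX t).const_mul (1 + 2 * γ)).sub (((hX t).pow 3).const_mul 2)).add
      (((((hX t).pow 2).sub_const γ).mul (hA X Y γ hne hX t)).add
      ((hZ t).mul ((hY t).mul ((hQ X Y γ hne hX t).const_add 1))))).congr_deriv ?_
    simp only [Pi.pow_apply, Pi.mul_apply]
    push_cast
    field_simp
    linear_combination (-2 * γ * Z t) * h

theorem mode0p (D V : ℝ → ℝ) (W : ℝ → ℝ) (a : ℝ) (hne : ∀ t, X t ≠ 0)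
    (hX : ∀ t, HasDerivAt X (Y t) t)
    (hY : ∀ t, HasDerivAt Y ((1 + 2 * γ) * X t - 2 * X t ^ 3) t)
    (hI : ∀ t, Y t ^ 2 = (1 + 2 * γ) * X t ^ 2 - X t ^ 4 - γ ^ 2)
    (hD : ∀ t, HasDerivAt D (W t) t)
    (hW : ∀ t, HasDerivAt W (D t * ((1 + 2 * γ) - 6 * X t ^ 2) + 2 * (1 + 2 * a) * X t) t)
    (hV : ∀ t, HasDerivAt V (2 * X t * D t - (1 + 2 * a)) t)
    (hJ : ∀ t, Y t * W t = (1 + 2 * γ) * X t * D t + (1 + 2 * a) * X t ^ 2 - 2 * X t ^ 3 * D t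
      - γ * (1 + 2 * a)) :
    ModeSol X γ 0 (fun t => -((X t ^ 2 - γ) / X t) * D t + (Y t / X t) * V t) := by
  refine ⟨fun t => (Y t * (1 - γ / X t ^ 2)) * D t - ((X t ^ 2 - γ) / X t) * W t
    + (-X t ^ 2 + γ ^ 2 / X t ^ 2) * V t - (1 + 2 * a) * (Y t / X t), fun t => ?_, fun t => ?_⟩
  · refine (((hA X Y γ hne hX t).neg.mul (hD t)).add
      ((hB X Y γ hne hX hY hI t).mul (hV t))).congr_deriv ?_
    have := hne t
    simp only [Pi.neg_apply]
    field_simp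
    ring
  · refine ((((((hY t).mul ((hQ X Y γ hne hX t).const_sub 1)).mul (hD t)).sub
      ((hA X Y γ hne hX t).mul (hW t))).add ((hB' X Y γ hne hX t).mul (hV t))).sub
      ((hB X Y γ hne hX hY hI t).const_mul (1 + 2 * a))).congr_deriv ?_
    have := hne t
    have h := hI t
    have hj := hJ t
    simp only [Pi.mul_apply]
    field_simp
    linear_combination (2 * γ * D t) * h - 2 * γ * X t * hj

end modes

/-- Jacobi fields of Delaunay surfaces: linear combinations of
w_{a,0}^±, w_{a,1}^± cos θ, w_{a,1}^± sin θ solve Δφ + 2(x_a² + γ_a²/x_a²)φ = 0 and are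
2π-periodic in θ. -/
theorem jacobi_fields_delaunay
    (a : ℝ) (ha1 : -(1/2 : ℝ) ≤ a) (ha2 : a ≠ 0)
    (x x' z : ℝ → ℝ → ℝ)
    (hx : ∀ b, -(1/2 : ℝ) ≤ b → b ≠ 0 → ∀ t, HasDerivAt (x b) (x' b t) t)
    (hx' : ∀ b, -(1/2 : ℝ) ≤ b → b ≠ 0 → ∀ t,
      HasDerivAt (x' b) ((1 + 2 * (b * (1 + b))) * x b t - 2 * x b t ^ 3) t)
    (hx0 : ∀ b, -(1/2 : ℝ) ≤ b → b ≠ 0 → x b 0 = 1 + b)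
    (hx'0 : ∀ b, -(1/2 : ℝ) ≤ b → b ≠ 0 → x' b 0 = 0)
    (hz : ∀ b, -(1/2 : ℝ) ≤ b → b ≠ 0 → ∀ t,
      HasDerivAt (z b) (x b t ^ 2 - b * (1 + b)) t)
    (hz0 : ∀ b, -(1/2 : ℝ) ≤ b → b ≠ 0 → z b 0 = 0)
    -- differentiability of the family with respect to the Delaunay parameter at b = a
    (dx dz : ℝ → ℝ)
    (hdx : ∀ t, HasDerivAt (fun b => x b t) (dx t) a)
    (hdz : ∀ t, HasDerivAt (fun b => z b t) (dz t) a) :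
    ∀ (c₁ c₂ c₃ c₄ c₅ c₆ : ℝ) (φ : ℝ → ℝ → ℝ),
      (∀ t θ : ℝ, φ t θ =
          c₁ * (-((x a t ^ 2 - a * (1 + a)) / x a t) * dx t + (x' a t / x a t) * dz t)
          + c₂ * (x' a t / x a t)
          + c₃ * ((x a t ^ 2 - a * (1 + a)) / x a t) * Real.cos θ
          + c₄ * (x' a t + z a t * (x a t ^ 2 - a * (1 + a)) / x a t) * Real.cos θ
          + c₅ * ((x a t ^ 2 - a * (1 + a)) / x a t) * Real.sin θ
          + c₆ * (x' a t + z a t * (x a t ^ 2 - a * (1 + a)) / x a t) * Real.sin θ) →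
      (∀ t θ : ℝ,
        pt (pt φ) t θ + pθ (pθ φ) t θ
          + 2 * (x a t ^ 2 + (a * (1 + a)) ^ 2 / x a t ^ 2) * φ t θ = 0) ∧
      (∀ t θ : ℝ, φ t (θ + 2 * Real.pi) = φ t θ) := by
  obtain ⟨W, hD, hW, hV, hD0, hW0⟩ := linearized a ha1 ha2 x x' z hx hx' hx0 hx'0 hz hz0 dx dz hdx hdz
  have hI := first_integral_s6 a (x a) (x' a) (hx a ha1 ha2) (hx' a ha1 ha2) (hx0 a ha1 ha2)
    (hx'0 a ha1 ha2)
  have hX := hx a ha1 ha2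
  have hY := hx' a ha1 ha2
  have hne : ∀ t, x a t ≠ 0 := by
    intro t h0
    have h1 := hI t
    rw [h0] at h1
    have h2 : a * (1 + a) ≠ 0 := mul_ne_zero ha2 (by linarith)
    have h3 := pow_pos (abs_pos.mpr h2) 2
    rw [sq_abs] at h3
    nlinarith [sq_nonneg (x' a t)]
  have hJ : ∀ t, x' a t * W t = (1 + 2 * (a * (1 + a))) * x a t * dx t + (1 + 2 * a) * x a t ^ 2
      - 2 * x a t ^ 3 * dx t - (a * (1 + a)) * (1 + 2 * a) := by
    intro t
    have h := const_of_hasDerivAt_zero (fun t => x' a t * W t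
      - ((1 + 2 * (a * (1 + a))) * (x a t * dx t) + (1 + 2 * a) * x a t ^ 2
      - 2 * (x a t ^ 3 * dx t))) (fun t => by
        refine (((hY t).mul (hW t)).sub (((((hX t).mul (hD t)).const_mul
          (1 + 2 * (a * (1 + a)))).add (((hX t).pow 2).const_mul (1 + 2 * a))).sub
          ((((hX t).pow 3).mul (hD t)).const_mul 2))).congr_deriv ?_
        simp only [Pi.pow_apply]
        push_cast
        ring) t
    simp only [hD0, hW0, hx0 a ha1 ha2, hx'0 a ha1 ha2] at h
    linear_combination h
  obtain ⟨p1, hp1, hp2⟩ := mode0p (x a) (x' a) (a * (1 + a)) dx dz W a hne hX hY hI hD hW hV hJ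
  obtain ⟨q1, hq1, hq2⟩ := mode0m (x a) (x' a) (a * (1 + a)) hne hX hY hI
  obtain ⟨r1, hr1, hr2⟩ := mode1p (x a) (x' a) (a * (1 + a)) hne hX hY hI
  obtain ⟨s1, hs1, hs2⟩ := mode1m (x a) (x' a) (z a) (a * (1 + a)) hne hX hY (hz a ha1 ha2) hI
  intro c₁ c₂ c₃ c₄ c₅ c₆ φ hφ
  refine ⟨fun t θ => ?_, fun t θ => by
    rw [hφ, hφ, Real.cos_add_two_pi, Real.sin_add_two_pi]⟩
  have e1 : ∀ s θ, pt φ s θ = c₁ * p1 s + c₂ * q1 s + c₃ * r1 s * Real.cos θ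
      + c₄ * s1 s * Real.cos θ + c₅ * r1 s * Real.sin θ + c₆ * s1 s * Real.sin θ := by
    intro s θ
    have := ((((((hp1 s).const_mul c₁).add ((hq1 s).const_mul c₂)).add
      (((hr1 s).const_mul c₃).mul_const (Real.cos θ))).add
      (((hs1 s).const_mul c₄).mul_const (Real.cos θ))).add
      (((hr1 s).const_mul c₅).mul_const (Real.sin θ))).add
      (((hs1 s).const_mul c₆).mul_const (Real.sin θ))
    refine Eq.trans ?_ this.deriv
    unfold pt
    congr 1
    funext u
    exact hφ u θ
  have e2 := ((((((hp2 t).const_mul c₁).add ((hq2 t).const_mul c₂)).add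
      (((hr2 t).const_mul c₃).mul_const (Real.cos θ))).add
      (((hs2 t).const_mul c₄).mul_const (Real.cos θ))).add
      (((hr2 t).const_mul c₅).mul_const (Real.sin θ))).add
      (((hs2 t).const_mul c₆).mul_const (Real.sin θ))
  have e3 := e2.deriv
  have e4 : pt (pt φ) t θ = _ := (congrArg (fun f => deriv f t) (funext fun u => e1 u θ)).trans e3
  have f1 : ∀ η, pθ φ t η =
      (c₃ * ((x a t ^ 2 - a * (1 + a)) / x a t)) * -Real.sin η
          + (c₄ * (x' a t + z a t * (x a t ^ 2 - a * (1 + a)) / x a t)) * -Real.sin η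
          + (c₅ * ((x a t ^ 2 - a * (1 + a)) / x a t)) * Real.cos η
          + (c₆ * (x' a t + z a t * (x a t ^ 2 - a * (1 + a)) / x a t)) * Real.cos η := by
    intro η
    have := (((((Real.hasDerivAt_cos η).const_mul
        (c₃ * ((x a t ^ 2 - a * (1 + a)) / x a t))).const_add
        (c₁ * (-((x a t ^ 2 - a * (1 + a)) / x a t) * dx t + (x' a t / x a t) * dz t)
          + c₂ * (x' a t / x a t))).add ((Real.hasDerivAt_cos η).const_mul
        (c₄ * (x' a t + z a t * (x a t ^ 2 - a * (1 + a)) / x a t)))).add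
        ((Real.hasDerivAt_sin η).const_mul (c₅ * ((x a t ^ 2 - a * (1 + a)) / x a t)))).add
        ((Real.hasDerivAt_sin η).const_mul
        (c₆ * (x' a t + z a t * (x a t ^ 2 - a * (1 + a)) / x a t)))
    refine Eq.trans ?_ this.deriv
    unfold pθ
    congr 1
    funext u
    exact hφ t u
  have f2 := (((((Real.hasDerivAt_sin θ).neg).const_mul
        (c₃ * ((x a t ^ 2 - a * (1 + a)) / x a t))).add ((Real.hasDerivAt_sin θ).neg.const_mul
        (c₄ * (x' a t + z a t * (x a t ^ 2 - a * (1 + a)) / x a t)))).add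
        ((Real.hasDerivAt_cos θ).const_mul (c₅ * ((x a t ^ 2 - a * (1 + a)) / x a t)))).add
        ((Real.hasDerivAt_cos θ).const_mul
        (c₆ * (x' a t + z a t * (x a t ^ 2 - a * (1 + a)) / x a t)))
  have f4 : pθ (pθ φ) t θ = _ := (congrArg (fun f => deriv f θ) (funext f1)).trans f2.deriv
  rw [e4, f4, hφ]
  ring

end Delaunay
end
end

section
/- Characterization of doubly periodic Jacobi fields. Let a ∈ (−1/2, 0) ∪ (0, (√3 − 1)/2]. If φ ∈ C²(ℝ²) solves Δφ + 2(x_a² + γ_a²/x_a²)φ = 0 on ℝ² and is doubly periodic with respect to a rectangle [−τ, τ] × [−π, π] for some τ > 0 (i.e., φ(t + 2τ, θ) = φ(t, θ) and φ(t, θ + 2π) = φ(t, θ) for all (t,θ)), then φ is a linear combination of the three functions (t,θ) ↦ x_a'(t)/x_a(t), (t,θ) ↦ (z_a'(t)/x_a(t))cosθ, (t,θ) ↦ (z_a'(t)/x_a(t))sinθ. -/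
noncomputable section

namespace Delaunay

/-- Zero derivative everywhere gives constancy. -/
lemma const_of_zero {f f1 : ℝ → ℝ} (h : ∀ t, HasDerivAt f (f1 t) t) (h0 : ∀ t, f1 t = 0)
    (t : ℝ) : f t = f 0 := by
  apply is_const_of_deriv_eq_zero (fun t => (h t).differentiableAt)
  intro t
  rw [(h t).deriv, h0]

/-- Nonnegative derivative everywhere gives monotonicity. -/
lemma mono_of_nonneg {f f1 : ℝ → ℝ} (h : ∀ t, HasDerivAt f (f1 t) t) (h0 : ∀ t, 0 ≤ f1 t) :
    Monotone f := by
  apply monotone_of_deriv_nonneg (fun t => (h t).differentiableAt)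
  intro t
  rw [(h t).deriv]
  exact h0 t

lemma wronskian_const {p f f1 g g1 : ℝ → ℝ}
    (hf : ∀ t, HasDerivAt f (f1 t) t) (hf1 : ∀ t, HasDerivAt f1 (p t * f t) t)
    (hg : ∀ t, HasDerivAt g (g1 t) t) (hg1 : ∀ t, HasDerivAt g1 (p t * g t) t) (t : ℝ) :
    f t * g1 t - f1 t * g t = f 0 * g1 0 - f1 0 * g 0 :=
  const_of_zero (f := fun t => f t * g1 t - f1 t * g t)
    (fun t => ((hf t).mul (hg1 t)).sub ((hf1 t).mul (hg t))) (fun t => by ring) t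

/-- Every solution of a second-order linear ODE is a combination of two independent ones. -/
lemma solution_span {p f f1 g g1 h h1 : ℝ → ℝ}
    (hf : ∀ t, HasDerivAt f (f1 t) t) (hf1 : ∀ t, HasDerivAt f1 (p t * f t) t)
    (hg : ∀ t, HasDerivAt g (g1 t) t) (hg1 : ∀ t, HasDerivAt g1 (p t * g t) t)
    (hh : ∀ t, HasDerivAt h (h1 t) t) (hh1 : ∀ t, HasDerivAt h1 (p t * h t) t)
    (hW : g 0 * h1 0 - g1 0 * h 0 ≠ 0) :
    ∃ α β : ℝ, ∀ t, f t = α * g t + β * h t := by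
  refine ⟨(f 0 * h1 0 - f1 0 * h 0) / (g 0 * h1 0 - g1 0 * h 0),
    (g 0 * f1 0 - g1 0 * f 0) / (g 0 * h1 0 - g1 0 * h 0), fun t => ?_⟩
  have e1 := wronskian_const hf hf1 hh hh1 t
  have e2 := wronskian_const hg hg1 hf hf1 t
  have e3 := wronskian_const hg hg1 hh hh1 t
  set w := g 0 * h1 0 - g1 0 * h 0
  rw [← e1, ← e2]
  field_simp
  rw [← e3]
  ring

/-- Growth lemma. -/
lemma growth_zero {I r : ℝ → ℝ} {β M c B : ℝ} (hI : ∀ t, HasDerivAt I (r t ^ 2) t)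
    (hb : ∀ t, |β * r t * I t| ≤ M) (hc : 0 < c) (hlin : ∀ t, 0 ≤ t → c * t - B ≤ I t) :
    β = 0 := by
  by_contra hβ
  have hβ2 : 0 < β ^ 2 := by positivity
  have hmono : Monotone (fun t => 3 * M ^ 2 * t - β ^ 2 * I t ^ 3) := by
    apply mono_of_nonneg
      (fun t => ((hasDerivAt_id t).const_mul (3 * M ^ 2)).sub (((hI t).pow 3).const_mul (β ^ 2)))
    intro t
    have h1 : (β * r t * I t) ^ 2 ≤ M ^ 2 := by
      rw [← sq_abs]
      exact pow_le_pow_left₀ (abs_nonneg _) (hb t) 2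
    simp only [Nat.cast_ofNat]
    norm_num
    nlinarith
  set K := |β ^ 2 * I 0 ^ 3| with hK
  set R := (3 * M ^ 2 + K) / (β ^ 2 * (c / 2) ^ 3) with hR
  have hK0 : 0 ≤ K := abs_nonneg _
  have hden : 0 < β ^ 2 * (c / 2) ^ 3 := by positivity
  have hR0 : 0 ≤ R := by positivity
  have hBc : 0 ≤ 2 * |B| / c := by positivity
  set t := 1 + R + 2 * |B| / c with ht
  have ht1 : 1 ≤ t := by linarith
  have h0 := hmono (show (0:ℝ) ≤ t by linarith)
  simp only [mul_zero, zero_sub] at h0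
  have h1 : c / 2 * t ≤ I t := by
    refine le_trans ?_ (hlin t (by linarith))
    have : 2 * |B| / c ≤ t := by linarith
    rw [div_le_iff₀ hc] at this
    have := le_abs_self B
    linarith
  have h2 : (c / 2 * t) ^ 3 ≤ I t ^ 3 := pow_le_pow_left₀ (by positivity) h1 3
  have h3 : β ^ 2 * I 0 ^ 3 ≤ K := le_abs_self _
  have h4 : β ^ 2 * (c / 2) ^ 3 * t ^ 3 ≤ (3 * M ^ 2 + K) * t := by
    have : β ^ 2 * (c / 2 * t) ^ 3 ≤ β ^ 2 * I t ^ 3 := by gcongr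
    nlinarith
  have h5 : β ^ 2 * (c / 2) ^ 3 * t ^ 2 ≤ (3 * M ^ 2 + K) := by
    have : (β ^ 2 * (c / 2) ^ 3 * t ^ 2) * t ≤ (3 * M ^ 2 + K) * t := by nlinarith
    exact le_of_mul_le_mul_right this (by linarith)
  have h6 : t ^ 2 ≤ R := by
    rw [hR, le_div_iff₀ hden]
    linarith
  nlinarith

/-- Nonnegative potential: periodic solutions are constant, and vanish with the potential. -/
lemma periodic_nonneg {p f f1 : ℝ → ℝ} {T : ℝ} (hT : 0 < T)
    (hf : ∀ t, HasDerivAt f (f1 t) t) (hf1 : ∀ t, HasDerivAt f1 (p t * f t) t)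
    (hp : ∀ t, 0 ≤ p t) (hper : ∀ t, f (t + T) = f t) :
    (∀ t, f t = f 0) ∧ ∀ t, p t * f t ^ 2 = 0 := by
  have hper1 : ∀ t, f1 (t + T) = f1 t := by
    intro t
    have h1 : HasDerivAt (fun s => f (s + T)) (f1 (t + T)) t := (hf (t + T)).comp_add_const t T
    have h2 : (fun s => f (s + T)) = f := funext hper
    rw [h2] at h1
    exact h1.unique (hf t)
  have hd : ∀ t, HasDerivAt (fun t => f t * f1 t) (f1 t * f1 t + f t * (p t * f t)) t :=
    fun t => (hf t).mul (hf1 t)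
  have hmono := mono_of_nonneg hd (fun t => by
    have := hp t
    have := mul_nonneg this (mul_self_nonneg (f t))
    nlinarith [mul_self_nonneg (f1 t)])
  have hzero : ∀ t, f1 t * f1 t + f t * (p t * f t) = 0 := by
    intro t
    have hP : Function.Periodic (fun t => f t * f1 t) T := by
      intro t
      simp only [hper, hper1]
    have hconst : ∀ s t, f s * f1 s ≤ f t * f1 t := by
      intro s t
      obtain ⟨n, hn⟩ := exists_nat_ge ((s - t) / T)
      rw [div_le_iff₀ hT] at hn
      have h1 := hmono (show s ≤ t + n * T by linarith)
      have h2 := hP.nat_mul n t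
      simp only at h1 h2
      rw [h2] at h1
      exact h1
    have : (fun t => f t * f1 t) = fun _ => f 0 * f1 0 := by
      funext s
      exact le_antisymm (hconst _ _) (hconst _ _)
    have h1 := hd t
    rw [this] at h1
    exact h1.unique (hasDerivAt_const t _)
  have h1 : ∀ t, f1 t = 0 := by
    intro t
    have := hzero t
    have := mul_nonneg (hp t) (mul_self_nonneg (f t))
    have : f1 t * f1 t = 0 := by nlinarith [mul_self_nonneg (f1 t)]
    simpa using this
  refine ⟨const_of_zero hf h1, fun t => ?_⟩
  have := hzero t
  rw [h1] at this
  linarith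

/-- Bundled data of the profile curve. -/
structure Profile (γ : ℝ) (x u y s z : ℝ → ℝ) : Prop where
  dx : ∀ t, HasDerivAt x (x t * u t) t
  du : ∀ t, HasDerivAt u (-(y t * s t)) t
  dy : ∀ t, HasDerivAt y (u t * s t) t
  ds : ∀ t, HasDerivAt s (u t * y t) t
  dz : ∀ t, HasDerivAt z (x t * y t) t
  uy : ∀ t, u t ^ 2 + y t ^ 2 = 1
  sy : ∀ t, s t ^ 2 = y t ^ 2 + 4 * γ
  xsy : ∀ t, x t = (s t + y t) / 2
  u0 : u 0 = 0
  y0 : y 0 = 1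
  z0 : z 0 = 0

namespace Profile
variable {γ : ℝ} {x u y s z : ℝ → ℝ}

lemma bounds (P : Profile γ x u y s z) :
    ∃ S : ℝ, ∀ t, |u t| ≤ 1 ∧ |y t| ≤ 1 ∧ |s t| ≤ S ∧ |x t| ≤ S + 1 ∧ |u t * y t * s t| ≤ S := by
  refine ⟨1 + 4 * |γ| + 1, fun t => ?_⟩
  have h1 := P.uy t
  have h2 := P.sy t
  have hu : |u t| ≤ 1 := abs_le_one_iff_mul_self_le_one.2 (by nlinarith)
  have hy : |y t| ≤ 1 := abs_le_one_iff_mul_self_le_one.2 (by nlinarith)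
  have hs : |s t| ≤ 1 + 4 * |γ| + 1 := by
    refine abs_le_of_sq_le_sq ?_ (by positivity)
    nlinarith [le_abs_self γ, abs_nonneg γ, sq_nonneg (u t)]
  refine ⟨hu, hy, hs, ?_, ?_⟩
  · rw [P.xsy t, abs_div, abs_two]
    have := abs_add_le (s t) (y t)
    have := abs_nonneg (s t)
    linarith
  · rw [abs_mul, abs_mul]
    have : |u t| * |y t| ≤ 1 := mul_le_one₀ hu (abs_nonneg _) hy
    calc |u t| * |y t| * |s t| ≤ 1 * |s t| := by gcongr
      _ ≤ _ := by linarith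

lemma dE (P : Profile γ x u y s z) (t : ℝ) : HasDerivAt (fun t => u t * y t * s t)
    (-(1 + 4 * γ) + (4 + 8 * γ) * u t ^ 2 - 3 * u t ^ 4) t := by
  convert! ((P.du t).mul (P.dy t)).mul (P.ds t) using 1
  have h1 := P.uy t
  have h2 := P.sy t
  have h1' : y t ^ 2 = 1 - u t ^ 2 := by linarith
  have h3 : (-(y t * s t) * y t + u t * (u t * s t)) * s t + u t * y t * (u t * y t)
    = (-(y t ^ 2) + u t ^ 2) * s t ^ 2 + u t ^ 2 * y t ^ 2 := by ring
  simp only [Pi.mul_apply]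
  rw [h3, h2, h1']
  ring

/-- Bounded solutions of the mode-zero equation. -/
lemma mode0 (P : Profile γ x u y s z) (hγ : 0 < 1 + 4 * γ) (hs0 : s 0 ≠ 0) (hx0 : 2 * x 0 * y 0 ≠ 1)
    {f f1 : ℝ → ℝ} (hf : ∀ t, HasDerivAt f (f1 t) t)
    (hf1 : ∀ t, HasDerivAt f1 (-(s t ^ 2 + y t ^ 2) * f t) t)
    {M : ℝ} (hM : ∀ t, |f t| ≤ M) : ∃ α, ∀ t, f t = α * u t := by
  obtain ⟨S, hS⟩ := P.bounds
  have hdu : ∀ t, HasDerivAt (fun t => -(y t * s t)) (-(s t ^ 2 + y t ^ 2) * u t) t := by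
    intro t
    convert! ((P.dy t).mul (P.ds t)).neg using 1
    ring
  have hv : ∀ t, HasDerivAt (fun t => u t * (2 * z t - t) - 2 * (x t * y t) + 1)
      (-(y t * s t) * (2 * z t - t) + u t * (2 * (x t * y t) - 1)
        - 2 * (x t * u t * y t + x t * (u t * s t))) t := fun t =>
    (((P.du t).mul (((P.dz t).const_mul 2).sub (hasDerivAt_id t))).sub
      (((P.dx t).mul (P.dy t)).const_mul 2)).add_const 1
  have hv1 : ∀ t, HasDerivAt (fun t => -(y t * s t) * (2 * z t - t) + u t * (2 * (x t * y t) - 1)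
        - 2 * (x t * u t * y t + x t * (u t * s t)))
      (-(s t ^ 2 + y t ^ 2) * (u t * (2 * z t - t) - 2 * (x t * y t) + 1)) t := by
    intro t
    convert! (((hdu t).mul (((P.dz t).const_mul 2).sub (hasDerivAt_id t))).add
      ((P.du t).mul ((((P.dx t).mul (P.dy t)).const_mul 2).sub_const 1))).sub
      (((((P.dx t).mul (P.du t)).mul (P.dy t)).add
        ((P.dx t).mul ((P.du t).mul (P.ds t)))).const_mul 2) using 1
    have h1 := P.uy t
    have h2 := P.sy t
    have hu : u t ^ 2 = 1 - y t ^ 2 := by linarith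
    simp only [Pi.mul_apply, id, Pi.sub_apply]
    rw [P.xsy t]
    linear_combination (s t + y t) ^ 2 * h1
  obtain ⟨α, β, hab⟩ := solution_span hf hf1 P.du hdu hv hv1 (by
    simp only [P.u0, P.y0, P.z0] at hx0 ⊢
    intro h
    have : s 0 * (1 - 2 * x 0) = 0 := by linarith
    rcases mul_eq_zero.1 this with h | h
    · exact hs0 h
    · apply hx0; linarith)
  have hI : ∀ t, HasDerivAt (fun t => t - 2 * z t - u t) (u t ^ 2) t := by
    intro t
    convert! ((hasDerivAt_id t).sub ((P.dz t).const_mul 2)).sub (P.du t) using 1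
    rw [P.xsy t]
    linarith [P.uy t]
  have hβ : β = 0 := by
    have hlin := mono_of_nonneg (fun t => (((hI t).const_mul (4 + 8 * γ)).sub (P.dE t)).sub
      ((hasDerivAt_id t).const_mul (1 + 4 * γ))) (fun t => by
        have : 0 ≤ u t ^ 4 := by positivity
        linarith)
    have hpos : 0 < 4 + 8 * γ := by linarith
    refine growth_zero (M := |β| * (1 + 2 * (S + 1) + 1) + |α| + M) (c := (1 + 4 * γ) / (4 + 8 * γ))
      (B := S / (4 + 8 * γ)) hI (fun t => ?_) (by positivity) (fun t ht => ?_)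
    · obtain ⟨bu, bY, bs, bx, -⟩ := hS t
      have e : β * u t * (t - 2 * z t - u t)
        = β * (-(u t * u t) - 2 * (x t * y t) + 1) + α * u t - f t := by
        rw [hab t]; ring
      rw [e]
      have b1 : |u t * u t| ≤ 1 := by
        rw [abs_mul]; exact mul_le_one₀ bu (abs_nonneg _) bu
      have b2 : |x t * y t| ≤ S + 1 := by
        rw [abs_mul]
        calc |x t| * |y t| ≤ |x t| * 1 := by gcongr
          _ ≤ _ := by linarith
      have b3 : |-(u t * u t) - 2 * (x t * y t) + 1| ≤ 1 + 2 * (S + 1) + 1 := by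
        rw [abs_le] at b1 b2 ⊢
        constructor <;> linarith
      have b4 : |α * u t| ≤ |α| := by
        rw [abs_mul]; exact mul_le_of_le_one_right (abs_nonneg _) bu
      have b5 : |β * (-(u t * u t) - 2 * (x t * y t) + 1)| ≤ |β| * (1 + 2 * (S + 1) + 1) := by
        rw [abs_mul]; gcongr
      have := abs_sub (β * (-(u t * u t) - 2 * (x t * y t) + 1) + α * u t) (f t)
      have := abs_add_le (β * (-(u t * u t) - 2 * (x t * y t) + 1)) (α * u t)
      linarith [hM t]
    · have h := hlin ht
      simp only [P.z0, P.u0, Pi.sub_apply, id] at h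
      have hb := (abs_le.1 (hS t).2.2.2.2).1
      rw [div_mul_eq_mul_div, ← sub_div, div_le_iff₀ hpos]
      linarith
  exact ⟨α, fun t => by rw [hab t, hβ]; ring⟩

/-- Bounded solutions of the mode-one equation. -/
lemma mode1 (P : Profile γ x u y s z) (hγ : γ ≠ 0) (hx0 : x 0 ≠ 0) (hs0 : s 0 ≠ 1)
    {f f1 : ℝ → ℝ} (hf : ∀ t, HasDerivAt f (f1 t) t)
    (hf1 : ∀ t, HasDerivAt f1 ((1 - (s t ^ 2 + y t ^ 2)) * f t) t)
    {M : ℝ} (hM : ∀ t, |f t| ≤ M) : ∃ α, ∀ t, f t = α * y t := by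
  obtain ⟨S, hS⟩ := P.bounds
  have hdy : ∀ t, HasDerivAt (fun t => u t * s t) ((1 - (s t ^ 2 + y t ^ 2)) * y t) t := by
    intro t
    convert! ((P.du t).mul (P.ds t)) using 1
    linear_combination (-y t) * P.uy t
  have hv : ∀ t, HasDerivAt (fun t => x t * u t + z t * y t)
      (x t * u t * u t + x t * -(y t * s t) + (x t * y t * y t + z t * (u t * s t))) t := fun t =>
    ((P.dx t).mul (P.du t)).add ((P.dz t).mul (P.dy t))
  have hv1 : ∀ t, HasDerivAt (fun t =>
        x t * u t * u t + x t * -(y t * s t) + (x t * y t * y t + z t * (u t * s t)))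
      ((1 - (s t ^ 2 + y t ^ 2)) * (x t * u t + z t * y t)) t := by
    intro t
    convert! ((((P.dx t).mul (P.du t)).mul (P.du t)).add ((P.dx t).mul ((P.dy t).mul (P.ds t)).neg)).add
      ((((P.dx t).mul (P.dy t)).mul (P.dy t)).add ((P.dz t).mul (hdy t))) using 1
    have h1 := P.uy t
    have h2 := P.sy t
    simp only [Pi.mul_apply, Pi.neg_apply]
    rw [P.xsy t]
    linear_combination (-(s t + y t) / 2 * u t) * h1
  obtain ⟨α, β, hab⟩ := solution_span hf hf1 P.dy hdy hv hv1 (by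
    simp only [P.u0, P.y0, P.z0]
    intro h
    have : x 0 * (1 - s 0) = 0 := by linarith
    rcases mul_eq_zero.1 this with h | h
    · exact hx0 h
    · apply hs0; linarith)
  have hJ : ∀ t, HasDerivAt (fun t => 2 * z t + u t) (y t ^ 2) t := by
    intro t
    convert! ((P.dz t).const_mul 2).add (P.du t) using 1
    rw [P.xsy t]
    ring
  have hlin : ∃ c B : ℝ, 0 < c ∧ ∀ t, 0 ≤ t → c * t - B ≤ 2 * z t + u t := by
    rcases lt_or_gt_of_ne hγ with hg | hg
    · refine ⟨-4 * γ, 0, by linarith, fun t ht => ?_⟩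
      have hlin := mono_of_nonneg (fun t => (hJ t).sub
        ((hasDerivAt_id t).const_mul (-4 * γ))) (fun t => by
        have := P.sy t
        nlinarith [sq_nonneg (s t)])
      have h := hlin ht
      simp only [P.z0, P.u0, Pi.sub_apply, id] at h
      linarith
    · have hpos : 0 < 3 + 8 * γ := by linarith
      refine ⟨4 * γ / (3 + 8 * γ), S / (3 + 8 * γ), by positivity, fun t ht => ?_⟩
      have hlin := mono_of_nonneg (fun t => (((hJ t).const_mul (3 + 8 * γ)).add (P.dE t)).sub
        ((hasDerivAt_id t).const_mul (4 * γ))) (fun t => by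
        have h1 : u t ^ 2 = 1 - y t ^ 2 := by linarith [P.uy t]
        have h2 : u t ^ 4 = (1 - y t ^ 2) ^ 2 := by rw [← h1]; ring
        have h3 : 0 ≤ y t ^ 2 := sq_nonneg _
        have h4 : y t ^ 2 ≤ 1 := by nlinarith [sq_nonneg (u t)]
        rw [h2, h1]
        nlinarith)
      have h := hlin ht
      simp only [P.z0, P.u0, Pi.sub_apply, Pi.add_apply, id] at h
      have hb := (abs_le.1 (hS t).2.2.2.2).2
      rw [div_mul_eq_mul_div, ← sub_div, div_le_iff₀ hpos]
      linarith
  obtain ⟨c, B, hc, hlin⟩ := hlin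
  have hβ : β = 0 := by
    refine growth_zero (M := |β| * (2 * (S + 1) + 1) + 2 * |α| + 2 * M) hJ (fun t => ?_) hc hlin
    obtain ⟨bu, bY, bs, bx, -⟩ := hS t
    have e : β * y t * (2 * z t + u t)
        = β * (-2 * (x t * u t) + u t * y t) - 2 * (α * y t) + 2 * f t := by
      rw [hab t]; ring
    rw [e]
    have b1 : |u t * y t| ≤ 1 := by
      rw [abs_mul]; exact mul_le_one₀ bu (abs_nonneg _) bY
    have b2 : |x t * u t| ≤ S + 1 := by
      rw [abs_mul]
      calc |x t| * |u t| ≤ |x t| * 1 := by gcongr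
        _ ≤ _ := by linarith
    have b3 : |-2 * (x t * u t) + u t * y t| ≤ 2 * (S + 1) + 1 := by
      rw [abs_le] at b1 b2 ⊢
      constructor <;> linarith
    have b4 : |α * y t| ≤ |α| := by
      rw [abs_mul]; exact mul_le_of_le_one_right (abs_nonneg _) bY
    have b5 : |β * (-2 * (x t * u t) + u t * y t)| ≤ |β| * (2 * (S + 1) + 1) := by
      rw [abs_mul]; gcongr
    have b6 := hM t
    rw [abs_le] at b4 b5 b6 ⊢
    constructor <;> linarith
  exact ⟨α, fun t => by rw [hab t, hβ]; ring⟩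

/-- Higher modes vanish. -/
lemma modeN (P : Profile γ x u y s z) (hγ : 2 * γ ≤ 1) (hs0 : s 0 ≠ 0) {N : ℝ} (hN : 4 ≤ N)
    {f f1 : ℝ → ℝ} (hf : ∀ t, HasDerivAt f (f1 t) t)
    (hf1 : ∀ t, HasDerivAt f1 ((N - (s t ^ 2 + y t ^ 2)) * f t) t)
    {T : ℝ} (hT : 0 < T) (hper : ∀ t, f (t + T) = f t) (t : ℝ) : f t = 0 := by
  have hp : ∀ t, N - (s t ^ 2 + y t ^ 2) = N - 2 - 4 * γ + 2 * u t ^ 2 := by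
    intro t
    rw [P.sy t]
    linarith [P.uy t]
  obtain ⟨h1, h2⟩ := periodic_nonneg hT hf hf1 (fun t => by
    rw [hp t]; nlinarith [sq_nonneg (u t)]) hper
  by_contra hne
  have hu : ∀ r, u r = 0 := by
    intro r
    have h3 := h2 r
    rw [h1 r, ← h1 t, hp r] at h3
    have h4 : f t ^ 2 ≠ 0 := pow_ne_zero 2 hne
    have h5 := (mul_eq_zero.1 h3).resolve_right h4
    have : u r ^ 2 = 0 := by nlinarith [sq_nonneg (u r)]
    simpa using this
  have h3 := P.du 0
  have h4 : u = fun _ => 0 := funext hu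
  rw [h4] at h3
  have := h3.unique (hasDerivAt_const 0 (0:ℝ))
  rw [P.y0] at this
  apply hs0
  linarith

end Profile

/-- The profile of a Delaunay surface. -/
lemma profile_of (a : ℝ) (ha1 : -(1/2 : ℝ) < a) (ha2 : a ≠ 0) 
    (x x' z : ℝ → ℝ)
    (hx : ∀ t, HasDerivAt x (x' t) t)
    (hx' : ∀ t, HasDerivAt x' ((1 + 2 * (a * (1 + a))) * x t - 2 * x t ^ 3) t)
    (hx0 : x 0 = 1 + a) (hx'0 : x' 0 = 0)
    (hz : ∀ t, HasDerivAt z (x t ^ 2 - a * (1 + a)) t)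
    (hz0 : z 0 = 0) : (∀ t, x t ≠ 0) ∧ Profile (a * (1 + a)) x (fun t => x' t / x t)
      (fun t => (x t ^ 2 - a * (1 + a)) / x t) (fun t => (x t ^ 2 + a * (1 + a)) / x t) z := by
  set γ := a * (1 + a) with hγ
  have h1a : 1 + a ≠ 0 := by linarith
  have hγ0 : γ ≠ 0 := mul_ne_zero ha2 h1a
  have hfirst : ∀ t, x' t ^ 2 = x t ^ 2 - (x t ^ 2 - γ) ^ 2 := by
    intro t
    have h := const_of_zero
      (fun t => ((hx' t).pow 2).sub (((hx t).pow 2).sub ((((hx t).pow 2).sub_const γ).pow 2)))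
      (fun t => by simp; ring) t
    simp only [Pi.sub_apply, Pi.pow_apply, hx0, hx'0] at h
    have e : (0:ℝ) ^ 2 - ((1 + a) ^ 2 - ((1 + a) ^ 2 - γ) ^ 2) = 0 := by rw [hγ]; ring
    rw [e] at h
    linarith
  have hne : ∀ t, x t ≠ 0 := by
    intro t h
    have h1 := hfirst t
    rw [h] at h1
    have : 0 < γ ^ 2 := by positivity
    nlinarith [sq_nonneg (x' t)]
  refine ⟨hne, ⟨?_, ?_, ?_, ?_, ?_, ?_, ?_, ?_, ?_, ?_, hz0⟩⟩
  · intro t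
    convert! hx t using 1
    have := hne t
    field_simp
  · intro t
    convert! (hx' t).div (hx t) (hne t) using 1
    have := hne t
    field_simp
    linear_combination hfirst t
  · intro t
    convert! (((hx t).pow 2).sub_const γ).div (hx t) (hne t) using 1
    have := hne t
    simp
    field_simp
    ring
  · intro t
    convert! (((hx t).pow 2).add_const γ).div (hx t) (hne t) using 1
    have := hne t
    simp
    field_simp
    ring
  · intro t
    convert! hz t using 1
    have := hne t
    field_simp
  · intro t
    have := hne t
    field_simp
    linear_combination hfirst t
  · intro t
    have := hne t
    field_simp
    ring
  · intro t
    have := hne t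
    field_simp
    ring
  · simp [hx'0]
  · rw [hx0, hγ]
    field_simp
    ring

/-- A continuous periodic function whose higher Fourier modes vanish. -/
lemma fourier_low (g : ℝ → ℝ) (hg : Continuous g) (hper : ∀ θ, g (θ + 2 * Real.pi) = g θ)
    (hc : ∀ n : ℤ, 4 ≤ (n : ℝ) ^ 2 → ∫ θ in (0:ℝ)..2 * Real.pi, g θ * Real.cos (n * θ) = 0)
    (hs : ∀ n : ℤ, 4 ≤ (n : ℝ) ^ 2 → ∫ θ in (0:ℝ)..2 * Real.pi, g θ * Real.sin (n * θ) = 0)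
    (θ : ℝ) :
    g θ = (1 / (2 * Real.pi)) * ((∫ θ in (0:ℝ)..2 * Real.pi, g θ * Real.cos ((0 : ℤ) * θ))
      + 2 * (∫ θ in (0:ℝ)..2 * Real.pi, g θ * Real.cos ((1 : ℤ) * θ)) * Real.cos θ
      + 2 * (∫ θ in (0:ℝ)..2 * Real.pi, g θ * Real.sin ((1 : ℤ) * θ)) * Real.sin θ) := by
  have hpi := Real.pi_pos
  have : Fact (0 < 2 * Real.pi) := ⟨by positivity⟩
  set C : ℤ → ℝ := fun n => ∫ θ in (0:ℝ)..2 * Real.pi, g θ * Real.cos (n * θ) with hC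
  set S : ℤ → ℝ := fun n => ∫ θ in (0:ℝ)..2 * Real.pi, g θ * Real.sin (n * θ) with hS
  have hP : Function.Periodic (fun θ => (g θ : ℂ)) (2 * Real.pi) := by
    intro θ
    simp [hper]
  let f : C(AddCircle (2 * Real.pi), ℂ) :=
    ⟨hP.lift, by
      apply Continuous.quotient_lift
      exact Complex.continuous_ofReal.comp hg⟩
  have hf : ∀ θ : ℝ, f (θ : AddCircle (2 * Real.pi)) = (g θ : ℂ) := fun θ => rfl
  have hfour : ∀ (n : ℤ) (θ : ℝ), fourier n (θ : AddCircle (2 * Real.pi))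
      = ((Real.cos (n * θ) : ℝ) : ℂ) + ((Real.sin (n * θ) : ℝ) : ℂ) * Complex.I := by
    intro n θ
    rw [fourier_coe_apply]
    have : 2 * (Real.pi : ℂ) * Complex.I * n * θ / ((2 * Real.pi : ℝ) : ℂ)
      = ((n * θ : ℝ) : ℂ) * Complex.I := by
      have : (Real.pi : ℂ) ≠ 0 := by exact_mod_cast hpi.ne'
      push_cast
      field_simp
    rw [this, Complex.exp_mul_I]
    push_cast
    rfl
  have hcoef : ∀ n : ℤ, fourierCoeff f n
      = ((1 / (2 * Real.pi) : ℝ) : ℂ) * ((C n : ℂ) - (S n : ℂ) * Complex.I) := by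
    intro n
    rw [fourierCoeff_eq_intervalIntegral f n 0, zero_add]
    have e : ∀ x : ℝ, (fourier (-n) (x : AddCircle (2 * Real.pi)) : ℂ) • f (x : AddCircle (2 * Real.pi))
        = ((g x * Real.cos (n * x) : ℝ) : ℂ) - ((g x * Real.sin (n * x) : ℝ) : ℂ) * Complex.I := by
      intro x
      rw [hfour, hf]
      push_cast
      simp only [neg_mul, Complex.cos_neg, Complex.sin_neg, smul_eq_mul]
      ring
    simp_rw [e]
    have i1 : IntervalIntegrable (fun x => ((g x * Real.cos (n * x) : ℝ) : ℂ))
        MeasureTheory.volume 0 (2 * Real.pi) :=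
      Continuous.intervalIntegrable (by fun_prop) _ _
    have i2 : IntervalIntegrable (fun x => ((g x * Real.sin (n * x) : ℝ) : ℂ) * Complex.I)
        MeasureTheory.volume 0 (2 * Real.pi) :=
      Continuous.intervalIntegrable (by fun_prop) _ _
    rw [intervalIntegral.integral_sub i1 i2, intervalIntegral.integral_mul_const,
      intervalIntegral.integral_ofReal, intervalIntegral.integral_ofReal]
    rw [Complex.real_smul]
  have hzero : ∀ n : ℤ, n ∉ ({-1, 0, 1} : Finset ℤ) → fourierCoeff f n = 0 := by
    intro n hn
    have hn2 : 4 ≤ (n : ℝ) ^ 2 := by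
      have : 4 ≤ n ^ 2 := by
        simp only [Finset.mem_insert, Finset.mem_singleton, not_or] at hn
        obtain ⟨h1, h2, h3⟩ := hn
        rcases le_or_gt n (-2) with h | h
        · nlinarith
        · have : 2 ≤ n := by omega
          nlinarith
      exact_mod_cast this
    rw [hcoef]
    simp only [hC, hS]
    rw [hc n hn2, hs n hn2]
    simp
  have hsum : Summable (fourierCoeff f) :=
    summable_of_ne_finset_zero (s := {-1, 0, 1}) hzero
  have h1 := has_pointwise_sum_fourier_series_of_summable hsum (θ : AddCircle (2 * Real.pi))
  have h2 := hasSum_sum_of_ne_finset_zero (L := SummationFilter.unconditional ℤ)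
    (f := fun i => fourierCoeff f i • fourier i (θ : AddCircle (2 * Real.pi)))
    (s := {-1, 0, 1}) (fun n hn => by simp only [hzero n hn, zero_smul])
  have h3 := h1.unique h2
  rw [Finset.sum_insert (by decide), Finset.sum_insert (by decide), Finset.sum_singleton,
    hf] at h3
  simp only [hcoef, hfour, smul_eq_mul] at h3
  have hCm : C (-1) = C 1 := by simp [hC]
  have hSm : S (-1) = - S 1 := by simp [hS]
  have hS0 : S 0 = 0 := by simp [hS]
  rw [hCm, hSm, hS0] at h3
  have h4 := congrArg Complex.re h3
  simp only [Complex.add_re, Complex.mul_re, Complex.sub_re, Complex.sub_im, Complex.add_im,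
    Complex.mul_im, Complex.ofReal_re, Complex.ofReal_im, Complex.I_re, Complex.I_im] at h4
  simp only [Int.cast_neg, Int.cast_one, Int.cast_zero, neg_mul, one_mul, zero_mul, Real.cos_neg,
    Real.sin_neg, Real.cos_zero, Real.sin_zero] at h4
  rw [h4]
  ring

lemma pt_facts {n : ℕ∞} {φ : ℝ → ℝ → ℝ}
    (h : ContDiff ℝ ((n + 1 : ℕ∞) : WithTop ℕ∞) (fun p : ℝ × ℝ => φ p.1 p.2)) :
    (∀ t θ, HasDerivAt (fun s => φ s θ) (pt φ t θ) t) ∧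
      ContDiff ℝ n (fun p : ℝ × ℝ => pt φ p.1 p.2) := by
  have hd : ∀ t θ, HasDerivAt (fun s => φ s θ)
      (fderiv ℝ (fun p : ℝ × ℝ => φ p.1 p.2) (t, θ) (1, 0)) t := by
    intro t θ
    have h1 : HasFDerivAt (fun p : ℝ × ℝ => φ p.1 p.2) _ (t, θ) :=
      (h.differentiable (by simp) (t, θ)).hasFDerivAt
    have h2 : HasDerivAt (fun s : ℝ => (s, θ)) ((1 : ℝ), (0 : ℝ)) t :=
      (hasDerivAt_id t).prodMk (hasDerivAt_const t θ)
    exact h1.comp_hasDerivAt t h2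
  have he : ∀ t θ, pt φ t θ = fderiv ℝ (fun p : ℝ × ℝ => φ p.1 p.2) (t, θ) (1, 0) :=
    fun t θ => (hd t θ).deriv
  refine ⟨fun t θ => by rw [he]; exact hd t θ, ?_⟩
  simp only [he]
  exact (h.fderiv_right (m := n) (by push_cast; rfl)).clm_apply contDiff_const

lemma pθ_facts {n : ℕ∞} {φ : ℝ → ℝ → ℝ}
    (h : ContDiff ℝ ((n + 1 : ℕ∞) : WithTop ℕ∞) (fun p : ℝ × ℝ => φ p.1 p.2)) :
    (∀ t θ, HasDerivAt (fun s => φ t s) (pθ φ t θ) θ) ∧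
      ContDiff ℝ n (fun p : ℝ × ℝ => pθ φ p.1 p.2) := by
  have hd : ∀ t θ, HasDerivAt (fun s => φ t s)
      (fderiv ℝ (fun p : ℝ × ℝ => φ p.1 p.2) (t, θ) (0, 1)) θ := by
    intro t θ
    have h1 : HasFDerivAt (fun p : ℝ × ℝ => φ p.1 p.2) _ (t, θ) :=
      (h.differentiable (by simp) (t, θ)).hasFDerivAt
    have h2 : HasDerivAt (fun s : ℝ => (t, s)) ((0 : ℝ), (1 : ℝ)) θ :=
      (hasDerivAt_const θ t).prodMk (hasDerivAt_id θ)
    exact h1.comp_hasDerivAt θ h2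
  have he : ∀ t θ, pθ φ t θ = fderiv ℝ (fun p : ℝ × ℝ => φ p.1 p.2) (t, θ) (0, 1) :=
    fun t θ => (hd t θ).deriv
  refine ⟨fun t θ => by rw [he]; exact hd t θ, ?_⟩
  simp only [he]
  exact (h.fderiv_right (m := n) (by push_cast; rfl)).clm_apply contDiff_const

/-- Differentiation under the integral sign. -/
lemma deriv_integral {ψ ψ1 : ℝ → ℝ → ℝ} {e : ℝ → ℝ} (he : Continuous e)
    (hψ : Continuous (fun p : ℝ × ℝ => ψ p.1 p.2))
    (hψ1 : Continuous (fun p : ℝ × ℝ => ψ1 p.1 p.2))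
    (hd : ∀ t θ, HasDerivAt (fun s => ψ s θ) (ψ1 t θ) t) (t b : ℝ) :
    HasDerivAt (fun t => ∫ θ in (0:ℝ)..b, ψ t θ * e θ) (∫ θ in (0:ℝ)..b, ψ1 t θ * e θ) t := by
  have hc : ∀ t, Continuous (fun θ => ψ t θ * e θ) := fun t =>
    (hψ.comp (continuous_const.prodMk continuous_id)).mul he
  have hc1 : ∀ t, Continuous (fun θ => ψ1 t θ * e θ) := fun t =>
    (hψ1.comp (continuous_const.prodMk continuous_id)).mul he
  have hK : IsCompact (Metric.closedBall t 1 ×ˢ Set.uIcc (0:ℝ) b) :=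
    (isCompact_closedBall t 1).prod isCompact_uIcc
  obtain ⟨K, hKb⟩ := hK.exists_bound_of_continuousOn
    (f := fun p : ℝ × ℝ => ψ1 p.1 p.2 * e p.2) (hψ1.mul (he.comp continuous_snd)).continuousOn
  refine (intervalIntegral.hasDerivAt_integral_of_dominated_loc_of_deriv_le
    (F := fun t θ => ψ t θ * e θ) (F' := fun t θ => ψ1 t θ * e θ) (bound := fun _ => K)
    (Metric.closedBall_mem_nhds t one_pos)
    (Filter.Eventually.of_forall fun t => (hc t).aestronglyMeasurable)
    ((hc t).intervalIntegrable _ _) (hc1 t).aestronglyMeasurable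
    (Filter.Eventually.of_forall fun θ hθ r hr => ?_)
    (continuous_const.intervalIntegrable _ _)
    (Filter.Eventually.of_forall fun θ hθ r hr => ?_)).2
  · exact hKb (r, θ) ⟨hr, Set.uIoc_subset_uIcc hθ⟩
  · exact (hd r θ).mul_const _

/-- Fourier modes of a doubly periodic Jacobi field solve the mode equations. -/
lemma mode_eq {φ : ℝ → ℝ → ℝ} (hφ : ContDiff ℝ 2 (fun p : ℝ × ℝ => φ p.1 p.2))
    (hper2 : ∀ t θ : ℝ, φ t (θ + 2 * Real.pi) = φ t θ) {q : ℝ → ℝ}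
    (hpde : ∀ t θ : ℝ, pt (pt φ) t θ + pθ (pθ φ) t θ + q t * φ t θ = 0)
    {e e1 : ℝ → ℝ} {N : ℝ} (he : ∀ θ, HasDerivAt e (e1 θ) θ)
    (he1 : ∀ θ, HasDerivAt e1 (-N * e θ) θ)
    (hep : e (2 * Real.pi) = e 0) (hep1 : e1 (2 * Real.pi) = e1 0) :
    ∃ F1 : ℝ → ℝ, (∀ t, HasDerivAt (fun t => ∫ θ in (0:ℝ)..2 * Real.pi, φ t θ * e θ) (F1 t) t) ∧
      ∀ t, HasDerivAt F1 ((N - q t) * ∫ θ in (0:ℝ)..2 * Real.pi, φ t θ * e θ) t := by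
  obtain ⟨ht, hct⟩ := pt_facts (n := 1) (φ := φ) hφ
  obtain ⟨hθ, hcθ⟩ := pθ_facts (n := 1) (φ := φ) hφ
  obtain ⟨htt, hctt⟩ := pt_facts (n := 0) (φ := pt φ) (by simpa using hct)
  obtain ⟨hθθ, hcθθ⟩ := pθ_facts (n := 0) (φ := pθ φ) (by simpa using hcθ)
  have ce : Continuous e := continuous_iff_continuousAt.2 fun θ => (he θ).continuousAt
  have ce1 : Continuous e1 := continuous_iff_continuousAt.2 fun θ => (he1 θ).continuousAt
  refine ⟨fun t => ∫ θ in (0:ℝ)..2 * Real.pi, pt φ t θ * e θ,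
    fun t => deriv_integral ce hφ.continuous hct.continuous ht t _, fun t => ?_⟩
  convert! deriv_integral ce hct.continuous hctt.continuous htt t (2 * Real.pi) using 1
  have hsl : Continuous (fun θ : ℝ => (t, θ)) := continuous_const.prodMk continuous_id
  have c0 : Continuous (fun θ => φ t θ) := hφ.continuous.comp hsl
  have c2 : Continuous (fun θ => pθ (pθ φ) t θ) := hcθθ.continuous.comp hsl
  have hpp : pθ φ t (2 * Real.pi) = pθ φ t 0 := by
    have h1 : HasDerivAt (fun s => φ t (s + 2 * Real.pi)) (pθ φ t (0 + 2 * Real.pi)) 0 :=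
      (hθ t (0 + 2 * Real.pi)).comp_add_const 0 (2 * Real.pi)
    simp only [hper2] at h1
    have := h1.unique (hθ t 0)
    rwa [zero_add] at this
  have hibp : ∫ θ in (0:ℝ)..2 * Real.pi,
      (pθ (pθ φ) t θ * e θ + N * (φ t θ * e θ)) = 0 := by
    rw [intervalIntegral.integral_eq_sub_of_hasDerivAt
      (f := fun θ => pθ φ t θ * e θ - φ t θ * e1 θ)]
    · have := hper2 t 0
      rw [zero_add] at this
      rw [hpp, hep, hep1, this]
      ring
    · intro θ _
      convert! ((hθθ t θ).mul (he θ)).sub ((hθ t θ).mul (he1 θ)) using 1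
      ring
    · exact Continuous.intervalIntegrable (by fun_prop) _ _
  have hrw : ∀ θ, pt (pt φ) t θ * e θ =
      (N - q t) * (φ t θ * e θ) - (pθ (pθ φ) t θ * e θ + N * (φ t θ * e θ)) := by
    intro θ
    linear_combination e θ * hpde t θ
  simp_rw [hrw]
  rw [intervalIntegral.integral_sub, hibp, intervalIntegral.integral_const_mul, sub_zero]
  · exact Continuous.intervalIntegrable (by fun_prop) _ _
  · exact Continuous.intervalIntegrable (by fun_prop) _ _

lemma sin_int_two_pi (n : ℤ) : Real.sin (n * (2 * Real.pi)) = 0 := by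
  have := Real.sin_int_mul_pi (n * 2)
  push_cast at this
  rwa [mul_assoc] at this

lemma bounded_of_periodic {f : ℝ → ℝ} (hf : Continuous f) {T : ℝ} (hT : 0 < T)
    (hper : ∀ t, f (t + T) = f t) : ∃ M, ∀ t, |f t| ≤ M := by
  obtain ⟨M, hM⟩ := isCompact_Icc.exists_bound_of_continuousOn (s := Set.Icc 0 T) hf.continuousOn
  refine ⟨M, fun t => ?_⟩
  have hP : Function.Periodic f T := hper
  obtain ⟨r, hr, hfr⟩ := hP.exists_mem_Ico₀ hT t
  rw [hfr]
  exact hM r ⟨hr.1, hr.2.le⟩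

/-- Characterization of doubly periodic Jacobi fields for
a ∈ (−1/2, 0) ∪ (0, (√3 − 1)/2]. -/
theorem doubly_periodic_jacobi_fields
    (a : ℝ) (ha1 : -(1/2 : ℝ) < a) (ha2 : a ≠ 0) (ha3 : a ≤ (Real.sqrt 3 - 1) / 2)
    (x x' z : ℝ → ℝ)
    (hx : ∀ t, HasDerivAt x (x' t) t)
    (hx' : ∀ t, HasDerivAt x' ((1 + 2 * (a * (1 + a))) * x t - 2 * x t ^ 3) t)
    (hx0 : x 0 = 1 + a) (hx'0 : x' 0 = 0)
    (hz : ∀ t, HasDerivAt z (x t ^ 2 - a * (1 + a)) t)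
    (hz0 : z 0 = 0)
    (φ : ℝ → ℝ → ℝ)
    (hφ : ContDiff ℝ 2 (fun p : ℝ × ℝ => φ p.1 p.2))
    (τ : ℝ) (hτ : 0 < τ)
    (hper1 : ∀ t θ : ℝ, φ (t + 2 * τ) θ = φ t θ)
    (hper2 : ∀ t θ : ℝ, φ t (θ + 2 * Real.pi) = φ t θ)
    (hpde : ∀ t θ : ℝ,
      pt (pt φ) t θ + pθ (pθ φ) t θ
        + 2 * (x t ^ 2 + (a * (1 + a)) ^ 2 / x t ^ 2) * φ t θ = 0) :
    ∃ c₁ c₂ c₃ : ℝ, ∀ t θ : ℝ,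
      φ t θ = c₁ * (x' t / x t)
        + c₂ * ((x t ^ 2 - a * (1 + a)) / x t) * Real.cos θ
        + c₃ * ((x t ^ 2 - a * (1 + a)) / x t) * Real.sin θ := by
  obtain ⟨hne, P⟩ := profile_of a ha1 ha2 x x' z hx hx' hx0 hx'0 hz hz0
  set γ := a * (1 + a) with hγ
  have h1a : 1 + a ≠ 0 := by linarith
  have hγ0 : γ ≠ 0 := mul_ne_zero ha2 h1a
  have hγ4 : 0 < 1 + 4 * γ := by
    have : 0 < (1 + 2 * a) ^ 2 := by
      have : 0 < 1 + 2 * a := by linarith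
      positivity
    rw [hγ]
    linarith
  have hγ1 : 2 * γ ≤ 1 := by
    have h3 : Real.sqrt 3 ^ 2 = 3 := Real.sq_sqrt (by norm_num)
    have h4 : (1 + 2 * a) ^ 2 ≤ Real.sqrt 3 ^ 2 :=
      pow_le_pow_left₀ (by linarith) (by linarith) 2
    rw [hγ]
    linarith
  have hs0 : (x 0 ^ 2 + γ) / x 0 = 1 + 2 * a := by
    rw [hx0, hγ]
    field_simp
    ring
  have hy0 := P.y0
  have hq : ∀ t, 2 * (x t ^ 2 + γ ^ 2 / x t ^ 2)
      = ((x t ^ 2 + γ) / x t) ^ 2 + ((x t ^ 2 - γ) / x t) ^ 2 := by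
    intro t
    have := hne t
    field_simp
    ring
  simp only [hq] at hpde
  have hT : 0 < 2 * τ := by linarith
  have hFper : ∀ (e : ℝ → ℝ) t, (fun t => ∫ θ in (0:ℝ)..2 * Real.pi, φ t θ * e θ) (t + 2 * τ)
      = (fun t => ∫ θ in (0:ℝ)..2 * Real.pi, φ t θ * e θ) t := by
    intro e t
    simp only [hper1]
  have hcos : ∀ n : ℤ, ∃ F1 : ℝ → ℝ,
      (∀ t, HasDerivAt (fun t => ∫ θ in (0:ℝ)..2 * Real.pi, φ t θ * Real.cos (n * θ)) (F1 t) t) ∧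
      ∀ t, HasDerivAt F1 (((n : ℝ) ^ 2 - (((x t ^ 2 + γ) / x t) ^ 2 + ((x t ^ 2 - γ) / x t) ^ 2))
        * ∫ θ in (0:ℝ)..2 * Real.pi, φ t θ * Real.cos (n * θ)) t := by
    intro n
    have hl : ∀ θ : ℝ, HasDerivAt (fun θ : ℝ => (n : ℝ) * θ) n θ := fun θ => by
      simpa using (hasDerivAt_id θ).const_mul (n : ℝ)
    refine mode_eq hφ hper2 hpde (e := fun θ => Real.cos (n * θ))
      (e1 := fun θ => -Real.sin (n * θ) * n) (fun θ => (hl θ).cos) (fun θ => ?_) ?_ ?_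
    · convert! (hl θ).sin.neg.mul_const (n : ℝ) using 1
      ring
    · simp [Real.cos_int_mul_two_pi]
    · simpa using Or.inl (sin_int_two_pi n)
  have hsin : ∀ n : ℤ, ∃ F1 : ℝ → ℝ,
      (∀ t, HasDerivAt (fun t => ∫ θ in (0:ℝ)..2 * Real.pi, φ t θ * Real.sin (n * θ)) (F1 t) t) ∧
      ∀ t, HasDerivAt F1 (((n : ℝ) ^ 2 - (((x t ^ 2 + γ) / x t) ^ 2 + ((x t ^ 2 - γ) / x t) ^ 2))
        * ∫ θ in (0:ℝ)..2 * Real.pi, φ t θ * Real.sin (n * θ)) t := by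
    intro n
    have hl : ∀ θ : ℝ, HasDerivAt (fun θ : ℝ => (n : ℝ) * θ) n θ := fun θ => by
      simpa using (hasDerivAt_id θ).const_mul (n : ℝ)
    refine mode_eq hφ hper2 hpde (e := fun θ => Real.sin (n * θ))
      (e1 := fun θ => Real.cos (n * θ) * n) (fun θ => (hl θ).sin) (fun θ => ?_) ?_ ?_
    · convert! (hl θ).cos.mul_const (n : ℝ) using 1
      ring
    · simpa using sin_int_two_pi n
    · simp [Real.cos_int_mul_two_pi]
  have hbd : ∀ (e : ℝ → ℝ) {F1 : ℝ → ℝ}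
      (_ : ∀ t, HasDerivAt (fun t => ∫ θ in (0:ℝ)..2 * Real.pi, φ t θ * e θ) (F1 t) t),
      ∃ M, ∀ t, |(fun t => ∫ θ in (0:ℝ)..2 * Real.pi, φ t θ * e θ) t| ≤ M := fun e F1 h =>
    bounded_of_periodic (continuous_iff_continuousAt.2 fun t => (h t).continuousAt) hT (hFper e)
  have hs0' : (x 0 ^ 2 + γ) / x 0 ≠ 0 := by rw [hs0]; linarith
  obtain ⟨α, hα⟩ : ∃ α, ∀ t, (∫ θ in (0:ℝ)..2 * Real.pi, φ t θ * Real.cos ((0 : ℤ) * θ))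
      = α * (x' t / x t) := by
    obtain ⟨F1, h1, h2⟩ := hcos 0
    obtain ⟨M, hM⟩ := hbd _ h1
    refine P.mode0 hγ4 hs0' ?_ h1 (fun t => ?_) hM
    · intro h
      rw [hy0, hx0] at h
      linarith
    · convert! h2 t using 1
      simp
  have hk : ∀ {e F1 : ℝ → ℝ}
      (_ : ∀ t, HasDerivAt (fun t => ∫ θ in (0:ℝ)..2 * Real.pi, φ t θ * e θ) (F1 t) t)
      (_ : ∀ t, HasDerivAt F1 ((((1 : ℤ) : ℝ) ^ 2 -
          (((x t ^ 2 + γ) / x t) ^ 2 + ((x t ^ 2 - γ) / x t) ^ 2))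
        * ∫ θ in (0:ℝ)..2 * Real.pi, φ t θ * e θ) t),
      ∃ α, ∀ t, (∫ θ in (0:ℝ)..2 * Real.pi, φ t θ * e θ) = α * ((x t ^ 2 - γ) / x t) := by
    intro e F1 h1 h2
    obtain ⟨M, hM⟩ := hbd _ h1
    refine P.mode1 hγ0 (hne 0) ?_ h1 (fun t => ?_) hM
    · simp only [hs0]
      intro h
      apply ha2
      linarith
    · convert! h2 t using 1
      simp
  obtain ⟨β, hβ⟩ := let ⟨_, h1, h2⟩ := hcos 1; hk h1 h2
  obtain ⟨δ, hδ⟩ := let ⟨_, h1, h2⟩ := hsin 1; hk h1 h2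
  refine ⟨1 / (2 * Real.pi) * α, 1 / (2 * Real.pi) * (2 * β), 1 / (2 * Real.pi) * (2 * δ),
    fun t θ => ?_⟩
  have hcont : Continuous (fun θ => φ t θ) :=
    hφ.continuous.comp (continuous_const.prodMk continuous_id)
  have hfin := fourier_low (fun θ => φ t θ) hcont (hper2 t)
    (fun n hn => by
      obtain ⟨F1, h1, h2⟩ := hcos n
      exact P.modeN hγ1 hs0' hn h1 h2 hT (hFper _) t)
    (fun n hn => by
      obtain ⟨F1, h1, h2⟩ := hsin n
      exact P.modeN hγ1 hs0' hn h1 h2 hT (hFper _) t) θ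
  rw [hα t, hβ t, hδ t] at hfin
  rw [hfin]
  ring

end Delaunay
end
end
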